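/- arXiv:2104.03885 — 11 statements merged into one kernel-verified Lean document; each statement's English description precedes it below -/
import Mathlib

section
/- Let n ≥ 2 and m ≥ 1, and let (ρ₁, …, ρ_m) be a permutation system in S_n, i.e. a tuple of permutations of {1,…,n} with ρ₁ρ₂⋯ρ_m = 1. Then there exists a tuple (α₁, …, α_m) of elements of the braid group B_n with α₁α₂⋯α_m = 1 and π(α_j) = ρ_j for every j, such that in addition, for every j with ρ_j ≠ 1, writing k_j for the largest point of {1,…,n} moved by ρ_j (so 2 ≤ k_j ≤ n): (1) there exist β_j and γ_j in the subgroup of B_n generated by σ₁, …, σ_{k_j−2} and a sign ε_j ∈ {1, −1} such that α_j = β_j · σ_{k_j−1}^{ε_j} · γ_j; and (2) if moreover ρ_j is a transposition, then β_j and γ_j can be chosen with γ_j = β_j^{−1}, i.e. α_j = β_j · σ_{k_j−1}^{ε_j} · β_j^{−1}. -/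
/-- The braid relations on `m` generators: far commutation and the braid relation. -/
def braidRels (m : ℕ) : Set (FreeGroup (Fin m)) :=
  {r | (∃ i j : Fin m, (i : ℕ) + 2 ≤ (j : ℕ) ∧
          r = FreeGroup.of i * FreeGroup.of j * (FreeGroup.of i)⁻¹ * (FreeGroup.of j)⁻¹) ∨
       (∃ i j : Fin m, (i : ℕ) + 1 = (j : ℕ) ∧
          r = FreeGroup.of i * FreeGroup.of j * FreeGroup.of i *
              (FreeGroup.of j * FreeGroup.of i * FreeGroup.of j)⁻¹)}

/-- The braid group `B_n` on `n` strands, presented with the Artin generators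
`σ_1, …, σ_{n-1}` and the braid relations. -/
abbrev BraidGroup (n : ℕ) : Type := PresentedGroup (braidRels (n - 1))

/-- The Artin generator `σ_{i+1}` (`i` is the 0-based index, so `braidGen i`
corresponds to the classical generator `σ_{i+1}`). -/
def braidGen {n : ℕ} (i : Fin (n - 1)) : BraidGroup n := PresentedGroup.of i

/-- The point `i` of `{0, …, n-1}`, i.e. the 1-based point `i+1`. -/
def finLow {n : ℕ} (i : Fin (n - 1)) : Fin n := ⟨i.1, by have := i.isLt; omega⟩

/-- The point `i+1` of `{0, …, n-1}`, i.e. the 1-based point `i+2`. -/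
def finHigh {n : ℕ} (i : Fin (n - 1)) : Fin n := ⟨i.1 + 1, by have := i.isLt; omega⟩

open scoped Pointwise

namespace BraidLift

/-- Conjugating `s` by `t` when `s` and `t` satisfy the braid relation. -/
theorem conj_zpow_of_braid {G : Type*} [Group G] {s t : G} (h : s * t * s = t * s * t)
    (η ε : ℤ) (hη : η = 1 ∨ η = -1) :
    t ^ η * s ^ ε * (t ^ η)⁻¹ = (s ^ η)⁻¹ * t ^ ε * s ^ η := by
  have h1 : t * s * t⁻¹ = s⁻¹ * t * s := by
    rw [mul_inv_eq_iff_eq_mul, mul_assoc, mul_assoc, eq_inv_mul_iff_mul_eq, ← mul_assoc, h,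
      ← mul_assoc]
  have h2 : t⁻¹ * s * t = s * t * s⁻¹ := by
    rw [eq_mul_inv_iff_mul_eq, mul_assoc, mul_assoc, inv_mul_eq_iff_eq_mul, ← mul_assoc, h,
      ← mul_assoc]
  rcases hη with rfl | rfl
  · have e := congrArg (· ^ ε) h1
    have e' : (s⁻¹ * t * s) ^ ε = s⁻¹ * t ^ ε * s := by
      simpa using conj_zpow (i := ε) (a := s⁻¹) (b := t)
    simp only [conj_zpow, e'] at e
    simpa using e
  · have e := congrArg (· ^ ε) h2
    have e' : (t⁻¹ * s * t) ^ ε = t⁻¹ * s ^ ε * t := by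
      simpa using conj_zpow (i := ε) (a := t⁻¹) (b := s)
    simp only [conj_zpow, e'] at e
    simpa using e

/-- The Artin generator of index `i`, extended by `1` to all natural numbers. -/
def gen (n i : ℕ) : BraidGroup n := if h : i < n - 1 then braidGen ⟨i, h⟩ else 1

/-- The subgroup generated by the Artin generators of index `i` with `i + 1 < k`. -/
def lower (n k : ℕ) : Subgroup (BraidGroup n) :=
  Subgroup.closure {x : BraidGroup n | ∃ i : Fin (n - 1), (i : ℕ) + 1 < k ∧ x = braidGen i}

theorem gen_mem_lower {n i k : ℕ} (h : i + 1 < k) : gen n i ∈ lower n k := by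
  unfold gen
  split_ifs with hi
  · exact Subgroup.subset_closure ⟨⟨i, hi⟩, h, rfl⟩
  · exact one_mem _

theorem lower_mono {n j k : ℕ} (h : j ≤ k) : lower n j ≤ lower n k := by
  apply Subgroup.closure_mono
  rintro x ⟨i, hi, rfl⟩
  exact ⟨i, by omega, rfl⟩

theorem gen_commute {n i j : ℕ} (h : i + 2 ≤ j) : Commute (gen n i) (gen n j) := by
  unfold gen
  split_ifs with hi hj hj
  · have := PresentedGroup.one_of_mem (rels := braidRels (n - 1))
      (Or.inl ⟨⟨i, hi⟩, ⟨j, hj⟩, h, rfl⟩)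
    simp only [map_mul, map_inv] at this
    rw [mul_inv_eq_one, mul_inv_eq_iff_eq_mul] at this
    exact this
  · exact Commute.one_right _
  · exact Commute.one_left _
  · exact Commute.one_left _

theorem gen_braid {n i : ℕ} (h : i + 1 < n - 1) :
    gen n i * gen n (i + 1) * gen n i = gen n (i + 1) * gen n i * gen n (i + 1) := by
  unfold gen
  rw [dif_pos h, dif_pos (by omega : i < n - 1)]
  have := PresentedGroup.one_of_mem (rels := braidRels (n - 1))
      (Or.inr ⟨⟨i, by omega⟩, ⟨i + 1, h⟩, rfl, rfl⟩)
  simp only [map_mul, map_inv] at this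
  exact mul_inv_eq_one.1 this

theorem commute_gen_of_mem_lower {n k j : ℕ} (h : k ≤ j) {x : BraidGroup n}
    (hx : x ∈ lower n k) : Commute x (gen n j) := by
  induction hx using Subgroup.closure_induction with
  | mem x hx =>
    obtain ⟨i, hi, rfl⟩ := hx
    have := gen_commute (n := n) (i := i) (j := j) (by omega)
    rwa [gen, dif_pos i.isLt] at this
  | one => exact Commute.one_left _
  | mul x y _ _ hx hy => exact hx.mul_left hy
  | inv x _ hx => exact hx.inv_left

variable {n : ℕ} (pr : BraidGroup n →* Equiv.Perm (Fin n))

/-- Lifts of the transposition `(c k)` of the form `β σ β⁻¹` where `σ` is, up to sign,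
the generator exchanging `k - 1` and `k`, and `β` only involves lower generators. -/
def thin (c k : Fin n) : Set (BraidGroup n) :=
  {x | (∃ β ∈ lower n k, ∃ ε : ℤ, (ε = 1 ∨ ε = -1) ∧ x = β * gen n (k - 1) ^ ε * β⁻¹) ∧
    pr x = Equiv.swap c k}

/-- Products of thin lifts of the transpositions in a list. -/
def thinProd (l : List (Fin n × Fin n)) : Set (BraidGroup n) :=
  (l.map fun p => thin pr p.1 p.2).prod

/-- The product of the transpositions in a list. -/
def swapProd (l : List (Fin n × Fin n)) : Equiv.Perm (Fin n) :=
  (l.map fun p => Equiv.swap p.1 p.2).prod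

/-- The list of pairs `(c, k)` for `c` in `S`. -/
def star (k : Fin n) (S : List (Fin n)) : List (Fin n × Fin n) := S.map fun c => (c, k)

@[simp] theorem star_nil (k : Fin n) : star k [] = [] := rfl
@[simp] theorem star_cons (k c : Fin n) (S : List (Fin n)) :
    star k (c :: S) = (c, k) :: star k S := rfl
@[simp] theorem star_append (k : Fin n) (S S' : List (Fin n)) :
    star k (S ++ S') = star k S ++ star k S' := List.map_append
@[simp] theorem swapProd_nil : swapProd ([] : List (Fin n × Fin n)) = 1 := rfl
@[simp] theorem swapProd_cons (p : Fin n × Fin n) (l : List (Fin n × Fin n)) :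
    swapProd (p :: l) = Equiv.swap p.1 p.2 * swapProd l := by simp [swapProd]
@[simp] theorem swapProd_append (l l' : List (Fin n × Fin n)) :
    swapProd (l ++ l') = swapProd l * swapProd l' := by simp [swapProd]
@[simp] theorem thinProd_nil : thinProd pr [] = 1 := rfl
@[simp] theorem thinProd_cons (p : Fin n × Fin n) (l : List (Fin n × Fin n)) :
    thinProd pr (p :: l) = thin pr p.1 p.2 * thinProd pr l := by simp [thinProd]
@[simp] theorem thinProd_append (l l' : List (Fin n × Fin n)) :
    thinProd pr (l ++ l') = thinProd pr l * thinProd pr l' := by simp [thinProd]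

variable {pr}

theorem thin_inv {c k : Fin n} {x : BraidGroup n} (hx : x ∈ thin pr c k) :
    x⁻¹ ∈ thin pr c k := by
  obtain ⟨⟨β, hβ, ε, hε, rfl⟩, h⟩ := hx
  refine ⟨⟨β, hβ, -ε, by omega, by group⟩, ?_⟩
  rw [map_inv, h, Equiv.swap_inv]

theorem map_of_mem_thinProd {l : List (Fin n × Fin n)} {x : BraidGroup n}
    (hx : x ∈ thinProd pr l) : pr x = swapProd l := by
  induction l generalizing x with
  | nil => simp_all
  | cons p l ih =>
    rw [thinProd_cons] at hx
    obtain ⟨a, ha, b, hb, rfl⟩ := hx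
    rw [map_mul, ha.2, ih hb, swapProd_cons]

theorem thin_mem_lower {c k : Fin n} (hck : c < k) {m : ℕ} (hm : k.1 < m) {x : BraidGroup n}
    (hx : x ∈ thin pr c k) : x ∈ lower n m := by
  obtain ⟨⟨β, hβ, ε, hε, rfl⟩, h⟩ := hx
  have hβ' := lower_mono (n := n) hm.le hβ
  have : c.1 < k.1 := hck
  exact mul_mem (mul_mem hβ' (zpow_mem (gen_mem_lower (by omega)) _)) (inv_mem hβ')

theorem thinProd_mem_lower {m : ℕ} {l : List (Fin n × Fin n)}
    (hl : ∀ p ∈ l, p.1 < p.2 ∧ p.2.1 < m) {x : BraidGroup n}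
    (hx : x ∈ thinProd pr l) : x ∈ lower n m := by
  induction l generalizing x with
  | nil => simp_all
  | cons p l ih =>
    rw [thinProd_cons] at hx
    obtain ⟨a, ha, b, hb, rfl⟩ := hx
    rw [List.forall_mem_cons] at hl
    exact mul_mem (thin_mem_lower hl.1.1 hl.1.2 ha) (ih hl.2 hb)

theorem swapProd_apply_of_le {m : ℕ} {l : List (Fin n × Fin n)}
    (hl : ∀ p ∈ l, p.1 < p.2 ∧ p.2.1 < m) {q : Fin n} (hq : m ≤ q.1) : swapProd l q = q := by
  induction l with
  | nil => simp
  | cons p l ih =>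
    rw [List.forall_mem_cons] at hl
    rw [swapProd_cons, Equiv.Perm.mul_apply, ih hl.2]
    have : p.1.1 < p.2.1 := hl.1.1
    apply Equiv.swap_apply_of_ne_of_ne <;> (rw [Ne, Fin.ext_iff]; omega)

theorem swapProd_apply_lt {m : ℕ} {l : List (Fin n × Fin n)}
    (hl : ∀ p ∈ l, p.1 < p.2 ∧ p.2.1 < m) {q : Fin n} (hq : q.1 < m) :
    (swapProd l q).1 < m := by
  by_contra! h
  have h' := (swapProd l).injective (swapProd_apply_of_le hl h)
  omega

/-- Conjugation by a product of lower thin braids relabels a list of thin lifts at `k`. -/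
theorem conj_thinProd_star {k : Fin n} {l : List (Fin n × Fin n)}
    (hl : ∀ p ∈ l, p.1 < p.2 ∧ p.2 < k) {d : BraidGroup n} (hd : d ∈ thinProd pr l)
    {S : List (Fin n)} {x : BraidGroup n} (hx : x ∈ thinProd pr (star k (S.map (swapProd l)))) :
    d⁻¹ * x * d ∈ thinProd pr (star k S) := by
  have hdl := thinProd_mem_lower hl hd
  have hdk : swapProd l k = k := swapProd_apply_of_le hl le_rfl
  induction S generalizing x with
  | nil => simp_all
  | cons c S ih =>
    simp only [List.map_cons, star_cons, thinProd_cons] at hx ⊢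
    obtain ⟨a, ⟨⟨β, hβ, ε, hε, rfl⟩, ha⟩, b, hb, rfl⟩ := hx
    refine ⟨d⁻¹ * (β * gen n (k - 1) ^ ε * β⁻¹) * d,
      ⟨⟨d⁻¹ * β, mul_mem (inv_mem hdl) hβ, ε, hε, by group⟩, ?_⟩, _, ih hb, by
        simp only; group⟩
    have e := Equiv.swap_apply_apply (swapProd l) c k
    rw [hdk] at e
    rw [map_mul, map_mul, ha, map_inv, map_of_mem_thinProd hd, e]
    group

theorem conj_gen_mem_thin
    (hpr : ∀ i : Fin (n - 1), pr (braidGen i) = Equiv.swap (finLow i) (finHigh i))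
    {c k k' : Fin n} (hck : c < k) (hk : k'.1 = k.1 + 1) (η : ℤ) (hη : η = 1 ∨ η = -1)
    {x : BraidGroup n} (hx : x ∈ thin pr c k) :
    gen n k ^ η * x * (gen n k ^ η)⁻¹ ∈ thin pr c k' := by
  obtain ⟨⟨β, hβ, ε, hε, rfl⟩, h⟩ := hx
  have hck' : c.1 < k.1 := hck
  have hk' := k'.isLt
  refine ⟨⟨β * (gen n (k - 1) ^ η)⁻¹, mul_mem (lower_mono (by omega) hβ)
    (inv_mem (zpow_mem (gen_mem_lower (by omega)) _)), ε, hε, ?_⟩, ?_⟩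
  · have hb := gen_braid (n := n) (i := k.1 - 1) (by omega)
    rw [show k.1 - 1 + 1 = k.1 by omega] at hb
    have hc := conj_zpow_of_braid hb η ε hη
    have hcomm : gen n k ^ η * β = β * gen n k ^ η :=
      ((commute_gen_of_mem_lower le_rfl hβ).zpow_right η).eq.symm
    have hcomm' : β⁻¹ * (gen n k ^ η)⁻¹ = (gen n k ^ η)⁻¹ * β⁻¹ := by
      rw [← mul_inv_rev, hcomm, mul_inv_rev]
    rw [show k'.1 - 1 = k.1 by omega]
    calc gen n k ^ η * (β * gen n (k - 1) ^ ε * β⁻¹) * (gen n k ^ η)⁻¹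
        = (gen n k ^ η * β) * gen n (k - 1) ^ ε * (β⁻¹ * (gen n k ^ η)⁻¹) := by group
      _ = β * (gen n k ^ η * gen n (k - 1) ^ ε * (gen n k ^ η)⁻¹) * β⁻¹ := by
        rw [hcomm, hcomm']; group
      _ = _ := by rw [hc]; group
  · have hg : pr (gen n k) = Equiv.swap k k' := by
      rw [gen, dif_pos (by omega : k.1 < n - 1), hpr]
      congr 1
      exact Fin.ext hk.symm
    have hgη : pr (gen n k ^ η) = Equiv.swap k k' := by
      rcases hη with rfl | rfl <;> simp [hg]
    have e := Equiv.swap_apply_apply (Equiv.swap k k') c k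
    rw [Equiv.swap_apply_left, Equiv.swap_apply_of_ne_of_ne hck.ne
      (by rw [Ne, Fin.ext_iff]; omega)] at e
    rw [map_mul, map_mul, h, map_inv, hgη, e]

/-- There is a thin lift of `(M k)` carrying thin lifts of `(c M)` to thin lifts of `(c k)` by
conjugation in both directions. -/
theorem exists_thin_conj
    (hpr : ∀ i : Fin (n - 1), pr (braidGen i) = Equiv.swap (finLow i) (finHigh i))
    {M k : Fin n} (hMk : M < k) :
    ∃ B ∈ thin pr M k, ∀ c < M, ∀ x ∈ thin pr c M,
      B * x * B⁻¹ ∈ thin pr c k ∧ B⁻¹ * x * B ∈ thin pr c k := by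
  obtain ⟨k, hk⟩ := k
  have hMk' : M.1 + 1 ≤ k := hMk
  induction k, hMk' using Nat.le_induction with
  | base =>
    refine ⟨gen n M, ⟨⟨1, one_mem _, 1, Or.inl rfl, by simp⟩, ?_⟩, fun c hc x hx => ?_⟩
    · rw [gen, dif_pos (by omega : M.1 < n - 1), hpr]
      rfl
    · have h1 := conj_gen_mem_thin hpr (k' := ⟨M.1 + 1, hk⟩) hc rfl 1 (Or.inl rfl) hx
      have h2 := conj_gen_mem_thin hpr (k' := ⟨M.1 + 1, hk⟩) hc rfl (-1) (Or.inr rfl) hx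
      simp only [zpow_one, zpow_neg, inv_inv] at h1 h2
      exact ⟨h1, h2⟩
  | succ k hk' ih =>
    have hkn : k < n := by omega
    have hMk1 : M < (⟨k, hkn⟩ : Fin n) := hk'
    obtain ⟨B, hB, h⟩ := ih hkn hMk1
    have step {c : Fin n} (hc : c < ⟨k, hkn⟩) {x : BraidGroup n} (hx : x ∈ thin pr c ⟨k, hkn⟩) :
        gen n k * x * (gen n k)⁻¹ ∈ thin pr c ⟨k + 1, hk⟩ := by
      have h1 := conj_gen_mem_thin hpr (k' := ⟨k + 1, hk⟩) hc rfl 1 (Or.inl rfl) hx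
      simpa only [zpow_one] using h1
    refine ⟨gen n k * B * (gen n k)⁻¹, step hMk1 hB, fun c hc x hx => ?_⟩
    have hcomm : Commute x (gen n k) :=
      commute_gen_of_mem_lower hk' (thin_mem_lower hc (Nat.lt_succ_self _) hx)
    have e : (gen n k)⁻¹ * x * gen n k = x := by
      rw [mul_assoc, hcomm.eq, inv_mul_cancel_left]
    obtain ⟨h1, h2⟩ := h c hc x hx
    refine ⟨?_, ?_⟩
    · convert step (hc.trans hMk1) h1 using 1
      nth_rewrite 2 [← e]
      group
    · convert step (hc.trans hMk1) h2 using 1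
      nth_rewrite 2 [← e]
      group

theorem thinProd_nonempty
    (hpr : ∀ i : Fin (n - 1), pr (braidGen i) = Equiv.swap (finLow i) (finHigh i))
    {l : List (Fin n × Fin n)} (hl : ∀ p ∈ l, p.1 < p.2) : (thinProd pr l).Nonempty := by
  induction l with
  | nil => simp
  | cons p l ih =>
    rw [List.forall_mem_cons] at hl
    rw [thinProd_cons]
    obtain ⟨B, hB, -⟩ := exists_thin_conj hpr hl.1
    exact Set.Nonempty.mul ⟨B, hB⟩ (ih hl.2)

theorem swapProd_eq_of_subset
    (hpr : ∀ i : Fin (n - 1), pr (braidGen i) = Equiv.swap (finLow i) (finHigh i))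
    {l l' : List (Fin n × Fin n)} (hl : ∀ p ∈ l, p.1 < p.2)
    (h : thinProd pr l ⊆ thinProd pr l') : swapProd l = swapProd l' := by
  obtain ⟨x, hx⟩ := thinProd_nonempty hpr hl
  rw [← map_of_mem_thinProd hx, map_of_mem_thinProd (h hx)]

theorem conj_star_mem {M k : Fin n} {B : BraidGroup n}
    (hB : ∀ c < M, ∀ x ∈ thin pr c M, B * x * B⁻¹ ∈ thin pr c k)
    {S : List (Fin n)} (hS : ∀ c ∈ S, c < M) {x : BraidGroup n}
    (hx : x ∈ thinProd pr (star M S)) : B * x * B⁻¹ ∈ thinProd pr (star k S) := by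
  induction S generalizing x with
  | nil => simp_all
  | cons c S ih =>
    rw [List.forall_mem_cons] at hS
    simp only [star_cons, thinProd_cons] at hx ⊢
    obtain ⟨a, ha, b, hb, rfl⟩ := hx
    exact ⟨_, hB c hS.1 a ha, _, ih hS.2 hb, by simp only; group⟩

theorem swapProd_star_apply (k : Fin n) (S : List (Fin n)) :
    swapProd (star k S) k = k ∨ swapProd (star k S) k ∈ S := by
  induction S with
  | nil => simp
  | cons c S ih =>
    simp only [star_cons, swapProd_cons, Equiv.Perm.mul_apply]
    rcases ih with h | h
    · right; rw [h]; simp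
    · by_cases h1 : swapProd (star k S) k = c
      · left; rw [h1]; simp
      · by_cases h2 : swapProd (star k S) k = k
        · right; rw [h2]; simp
        · right
          rw [Equiv.swap_apply_of_ne_of_ne h1 h2]
          exact List.mem_cons_of_mem _ h

theorem star_lt {k : Fin n} {S : List (Fin n)} (hS : ∀ c ∈ S, c < k) {m : ℕ} (hm : k.1 < m) :
    ∀ p ∈ star k S, p.1 < p.2 ∧ p.2.1 < m := by
  intro p hp
  obtain ⟨c, hc, rfl⟩ := List.mem_map.1 hp
  exact ⟨hS c hc, hm⟩

theorem forall_lt_append {m : ℕ} {l l' : List (Fin n × Fin n)}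
    (hl : ∀ p ∈ l, p.1 < p.2 ∧ p.2.1 < m) (hl' : ∀ p ∈ l', p.1 < p.2 ∧ p.2.1 < m) :
    ∀ p ∈ l ++ l', p.1 < p.2 ∧ p.2.1 < m := by
  intro p hp
  rcases List.mem_append.1 hp with h | h
  exacts [hl p h, hl' p h]

/-- A nonempty star of transpositions at `k`, followed by lower transpositions and having
product `1`, can be replaced by a shorter star followed by lower transpositions. -/
theorem exists_shorter_star
    (hpr : ∀ i : Fin (n - 1), pr (braidGen i) = Equiv.swap (finLow i) (finHigh i))
    {k : Fin n} {S : List (Fin n)} (hS : ∀ c ∈ S, c < k) (hS0 : S ≠ [])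
    {l : List (Fin n × Fin n)} (hl : ∀ p ∈ l, p.1 < p.2 ∧ p.2 < k)
    (h : swapProd (star k S ++ l) = 1) :
    ∃ (S' : List (Fin n)) (l' : List (Fin n × Fin n)), S'.length < S.length ∧
      (∀ c ∈ S', c < k) ∧ (∀ p ∈ l', p.1 < p.2 ∧ p.2 < k) ∧
      thinProd pr (star k S' ++ l') ⊆ thinProd pr (star k S ++ l) := by
  obtain ⟨M, hM, hmax⟩ : ∃ M ∈ S, ∀ c ∈ S, c ≤ M := by
    obtain ⟨M, hM, h⟩ := S.toFinset.exists_max_image id (by simpa using hS0)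
    exact ⟨M, by simpa using hM, fun c hc => h c (by simpa using hc)⟩
  have hMk : M < k := hS M hM
  obtain ⟨S₀, S₁, rfl, hM0⟩ := List.eq_append_cons_of_mem hM
  simp only [List.forall_mem_append, List.forall_mem_cons] at hS hmax
  have hS0M : ∀ c ∈ S₀, c < M := fun c hc =>
    lt_of_le_of_ne (hmax.1 c hc) (by rintro rfl; exact hM0 hc)
  obtain ⟨B, hB, hBc⟩ := exists_thin_conj hpr hMk
  set e₀ := star M S₀
  have he₀k : ∀ p ∈ e₀, p.1 < p.2 ∧ p.2 < k := star_lt hS0M hMk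
  have he₀M : ∀ p ∈ e₀, p.1 < p.2 ∧ p.2.1 < M.1 + 1 := star_lt hS0M (Nat.lt_succ_self _)
  have hBe {e : BraidGroup n} (he : e ∈ thinProd pr e₀) :
      B * e ∈ thinProd pr (star k S₀) * thin pr M k :=
    ⟨_, conj_star_mem (fun c hc x hx => (hBc c hc x hx).1) hS0M he, B, hB, by simp only; group⟩
  have hMS : M ∈ S₁.map (swapProd e₀) := by
    have hperm : Equiv.swap M k * swapProd e₀ = swapProd (star k S₀) * Equiv.swap M k := by
      obtain ⟨e, he⟩ := thinProd_nonempty hpr fun p hp => (he₀k p hp).1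
      obtain ⟨a, ha, b, hb, hab⟩ := hBe he
      have := congrArg pr hab
      rw [map_mul, map_mul, map_of_mem_thinProd he, map_of_mem_thinProd ha, hb.2, hB.2] at this
      exact this.symm
    simp only [star_append, star_cons, swapProd_append, swapProd_cons] at h
    rw [← mul_assoc (swapProd (star k S₀)), ← hperm] at h
    have hk := Equiv.congr_fun h k
    simp only [Equiv.Perm.mul_apply, Equiv.Perm.one_apply] at hk
    rw [swapProd_apply_of_le hl le_rfl, Equiv.swap_apply_eq_iff, Equiv.swap_apply_right] at hk
    rcases swapProd_star_apply k S₁ with h1 | h1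
    · rw [h1, swapProd_apply_of_le he₀k le_rfl] at hk
      exact absurd hk hMk.ne'
    · exact List.mem_map.2 ⟨_, h1, hk⟩
  have hS1M : ∀ c ∈ S₁.map (swapProd e₀), c ≤ M := by
    intro c hc
    obtain ⟨c', hc', rfl⟩ := List.mem_map.1 hc
    exact Nat.lt_succ_iff.1 (swapProd_apply_lt he₀M (Nat.lt_succ_iff.2 (hmax.2.2 c' hc')))
  obtain ⟨Sa, Sb, hab, hMa⟩ := List.eq_append_cons_of_mem hMS
  rw [hab] at hS1M
  simp only [List.forall_mem_append, List.forall_mem_cons] at hS1M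
  have hSaM : ∀ c ∈ Sa, c < M := fun c hc =>
    lt_of_le_of_ne (hS1M.1 c hc) (by rintro rfl; exact hMa hc)
  set ea := star M Sa
  have heak : ∀ p ∈ ea, p.1 < p.2 ∧ p.2 < k := star_lt hSaM hMk
  refine ⟨Sb.map (swapProd ea), ea ++ e₀ ++ l, ?_, ?_, ?_, ?_⟩
  · have := congrArg List.length hab
    simp only [List.length_map, List.length_append, List.length_cons] at this ⊢
    omega
  · intro c hc
    obtain ⟨c', hc', rfl⟩ := List.mem_map.1 hc
    exact swapProd_apply_lt heak (lt_of_le_of_lt (hS1M.2.2 c' hc') hMk)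
  · exact forall_lt_append (forall_lt_append heak he₀k) hl
  · intro x hx
    simp only [thinProd_append] at hx
    obtain ⟨s, hs, _, ⟨_, ⟨a, ha, e, he, rfl⟩, d, hd, rfl⟩, rfl⟩ := hx
    have hs2 := conj_thinProd_star heak ha hs
    have hBa : B⁻¹ * a * B ∈ thinProd pr (star k Sa) := by
      have := conj_star_mem (B := B⁻¹) (k := k)
        (fun c hc x hx => by simpa using (hBc c hc x hx).2) hSaM ha
      simpa using this
    have hs3 : (B⁻¹ * a * B) * (B⁻¹ * (a⁻¹ * s * a)) ∈
        thinProd pr (star k (S₁.map (swapProd e₀))) := by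
      rw [hab, star_append, star_cons, thinProd_append, thinProd_cons]
      exact Set.mul_mem_mul hBa (Set.mul_mem_mul (thin_inv hB) hs2)
    have hs4 := conj_thinProd_star he₀k he hs3
    have hfin := Set.mul_mem_mul (Set.mul_mem_mul (hBe he) hs4) hd
    simp only [star_append, star_cons, thinProd_append, thinProd_cons]
    rw [← mul_assoc (thinProd pr (star k S₀))]
    convert hfin using 1
    group

/-- Lower transpositions can be moved to the right of those at the top point `k`. -/
theorem exists_star_append (k : Fin n) (l : List (Fin n × Fin n))
    (hl : ∀ p ∈ l, p.1 < p.2 ∧ p.2 ≤ k) :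
    ∃ (S : List (Fin n)) (l' : List (Fin n × Fin n)), (∀ c ∈ S, c < k) ∧
      (∀ p ∈ l', p.1 < p.2 ∧ p.2 < k) ∧
      thinProd pr (star k S ++ l') ⊆ thinProd pr l := by
  induction l with
  | nil => exact ⟨[], [], by simp, by simp, by simp⟩
  | cons p l ih =>
    rw [List.forall_mem_cons] at hl
    obtain ⟨S, l', hS, hl', hsub⟩ := ih hl.2
    obtain ⟨c, b⟩ := p
    rcases hl.1.2.eq_or_lt with hb | hb
    · simp only at hb
      subst hb
      refine ⟨c :: S, l', by simpa using ⟨hl.1.1, hS⟩, hl', ?_⟩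
      simp only [star_cons, List.cons_append, thinProd_cons]
      exact Set.mul_subset_mul_left hsub
    · have hp : ∀ q ∈ [(c, b)], q.1 < q.2 ∧ q.2 < k := by simpa using ⟨hl.1.1, hb⟩
      refine ⟨S.map (swapProd [(c, b)]), (c, b) :: l', ?_, ?_, ?_⟩
      · intro c' hc
        obtain ⟨c'', hc', rfl⟩ := List.mem_map.1 hc
        exact swapProd_apply_lt hp (hS _ hc')
      · simpa using ⟨⟨hl.1.1, hb⟩, fun a b h => hl' (a, b) h⟩
      · intro x hx
        simp only [thinProd_append, thinProd_cons] at hx ⊢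
        obtain ⟨s, hs, _, ⟨a, ha, d, hd, rfl⟩, rfl⟩ := hx
        have hs2 := conj_thinProd_star hp (d := a) (by simpa using ha) hs
        refine ⟨a, ha, _, hsub (a := a⁻¹ * s * a * d) ?_, by simp only; group⟩
        rw [thinProd_append]
        exact Set.mul_mem_mul hs2 hd

/-- Any list of transpositions with product `1` has thin lifts with product `1`. -/
theorem one_mem_thinProd
    (hpr : ∀ i : Fin (n - 1), pr (braidGen i) = Equiv.swap (finLow i) (finHigh i))
    (m : ℕ) (l : List (Fin n × Fin n)) (hl : ∀ p ∈ l, p.1 < p.2 ∧ p.2.1 < m)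
    (h : swapProd l = 1) : 1 ∈ thinProd pr l := by
  induction m generalizing l with
  | zero =>
    rcases l with _ | ⟨p, l⟩
    · simp
    · exact absurd (hl p (by simp)).2 (by omega)
  | succ m ih =>
    by_cases hm : m < n
    · have key (r : ℕ) (S : List (Fin n)) (l : List (Fin n × Fin n)) (hr : S.length ≤ r)
          (hS : ∀ c ∈ S, c < ⟨m, hm⟩) (hl : ∀ p ∈ l, p.1 < p.2 ∧ p.2 < ⟨m, hm⟩)
          (h : swapProd (star ⟨m, hm⟩ S ++ l) = 1) : 1 ∈ thinProd pr (star ⟨m, hm⟩ S ++ l) := by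
        induction r generalizing S l with
        | zero =>
          obtain rfl : S = [] := by simpa using hr
          exact ih l hl h
        | succ r ihr =>
          by_cases hS0 : S = []
          · subst hS0
            exact ih l hl h
          · obtain ⟨S', l', hlen, hS', hl', hsub⟩ := exists_shorter_star hpr hS hS0 hl h
            refine hsub (ihr S' l' (by omega) hS' hl' ?_)
            rw [← h]
            refine swapProd_eq_of_subset hpr (fun p hp => ?_) hsub
            exact (forall_lt_append (star_lt hS' (Nat.lt_succ_self m))
              (fun p hp => ⟨(hl' p hp).1, Nat.lt_succ_of_lt (hl' p hp).2⟩) p hp).1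
      obtain ⟨S, l', hS, hl', hsub⟩ := exists_star_append (pr := pr) ⟨m, hm⟩ l
        fun p hp => ⟨(hl p hp).1, Nat.lt_succ_iff.1 (hl p hp).2⟩
      refine hsub (key _ S l' le_rfl hS hl' ?_)
      rw [← h]
      refine swapProd_eq_of_subset hpr (fun p hp => ?_) hsub
      exact (forall_lt_append (star_lt hS (Nat.lt_succ_self m))
        (fun p hp => ⟨(hl' p hp).1, Nat.lt_succ_of_lt (hl' p hp).2⟩) p hp).1
    · exact ih l (fun p hp => ⟨(hl p hp).1, by have := p.2.isLt; omega⟩) h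

/-- Every permutation is a product of transpositions with decreasing largest moved points. -/
theorem exists_swapProd_eq (m : ℕ) (ρ : Equiv.Perm (Fin n)) (h : ∀ q : Fin n, m ≤ q.1 → ρ q = q) :
    ∃ l : List (Fin n × Fin n), (∀ p ∈ l, p.1 < p.2 ∧ p.2.1 < m) ∧
      l.Pairwise (fun p q => q.2 < p.2) ∧ swapProd l = ρ := by
  induction m generalizing ρ with
  | zero => exact ⟨[], by simp, by simp, by ext q; simp [h q (Nat.zero_le _)]⟩
  | succ m ih =>
    by_cases hf : ∀ q : Fin n, m ≤ q.1 → ρ q = q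
    · obtain ⟨l, h1, h2, h3⟩ := ih ρ hf
      exact ⟨l, fun p hp => ⟨(h1 p hp).1, Nat.lt_succ_of_lt (h1 p hp).2⟩, h2, h3⟩
    · push Not at hf
      obtain ⟨q, hq, hqq⟩ := hf
      have hqm : q.1 = m := by
        by_contra hne
        exact hqq (h q (by omega))
      have hlt : ρ q < q := by
        by_contra! hle
        rcases hle.eq_or_lt with h1 | h1
        · exact hqq h1.symm
        · have : q.1 < (ρ q).1 := h1
          exact hqq (ρ.injective (h (ρ q) (by omega)))
      obtain ⟨l, h1, h2, h3⟩ := ih (Equiv.swap (ρ q) q * ρ) (by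
        intro x hx
        by_cases hxq : x = q
        · subst hxq; simp
        · have hxm : m + 1 ≤ x.1 := by
            have : x.1 ≠ q.1 := fun h => hxq (Fin.ext h)
            omega
          rw [Equiv.Perm.mul_apply, h x hxm, Equiv.swap_apply_of_ne_of_ne _ hxq]
          rintro rfl
          have : (ρ q).1 < q.1 := hlt
          omega)
      refine ⟨(ρ q, q) :: l, ?_, ?_, ?_⟩
      · rw [List.forall_mem_cons]
        exact ⟨⟨hlt, by simp only; omega⟩,
          fun p hp => ⟨(h1 p hp).1, Nat.lt_succ_of_lt (h1 p hp).2⟩⟩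
      · rw [List.pairwise_cons]
        exact ⟨fun p hp => by have := (h1 p hp).2; rw [Fin.lt_def]; simp only; omega, h2⟩
      · rw [swapProd_cons, h3, Equiv.swap_mul_self_mul]

theorem swapProd_cons_apply {c k : Fin n} {l : List (Fin n × Fin n)}
    (hl : ∀ p ∈ l, p.1 < p.2 ∧ p.2 < k) : swapProd ((c, k) :: l) k = c := by
  rw [swapProd_cons, Equiv.Perm.mul_apply, swapProd_apply_of_le hl le_rfl, Equiv.swap_apply_right]

theorem swapProd_flatten (L : List (List (Fin n × Fin n))) :
    swapProd L.flatten = (L.map swapProd).prod := by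
  induction L with
  | nil => simp
  | cons l L ih => simp [ih]

theorem thinProd_flatten (L : List (List (Fin n × Fin n))) :
    thinProd pr L.flatten = (L.map (thinProd pr)).prod := by
  induction L with
  | nil => simp
  | cons l L ih => simp [ih]

end BraidLift

open BraidLift in
/-- Every permutation system `(ρ₁, …, ρ_m)` in `S_n` lifts to a braid
system `(α₁, …, α_m)` in `B_n` such that, for each `j` with `ρ_j ≠ 1`, writing `p` for
the largest point moved by `ρ_j` (so, 0-based, `1 ≤ p`), the braid `α_j` has the form
`β_j · σ_{p}^{±1} · γ_j` (0-based generator index `p - 1`, i.e. classical `σ_{k_j-1}`)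
with `β_j, γ_j` in the subgroup generated by the generators of index `< p - 1`
(classical `σ_1, …, σ_{k_j-2}`), and with `γ_j = β_j⁻¹` when `ρ_j` is a transposition. -/
theorem braid_system_lifts_permutation_system
    (n m : ℕ) (hn : 2 ≤ n) (hm : 1 ≤ m)
    (pr : BraidGroup n →* Equiv.Perm (Fin n))
    (hpr : ∀ i : Fin (n - 1), pr (braidGen i) = Equiv.swap (finLow i) (finHigh i))
    (ρ : Fin m → Equiv.Perm (Fin n))
    (hρ : (List.ofFn ρ).prod = 1) :
    ∃ α : Fin m → BraidGroup n,
      (List.ofFn α).prod = 1 ∧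
      (∀ j, pr (α j) = ρ j) ∧
      (∀ j : Fin m, ρ j ≠ 1 →
        ∀ p : Fin n, (ρ j p ≠ p ∧ ∀ q : Fin n, ρ j q ≠ q → q ≤ p) →
          ∃ _ : 1 ≤ p.1,
            ∃ β ∈ Subgroup.closure
                {x : BraidGroup n | ∃ i : Fin (n - 1), (i : ℕ) + 1 < p.1 ∧ x = braidGen i},
            ∃ γ ∈ Subgroup.closure
                {x : BraidGroup n | ∃ i : Fin (n - 1), (i : ℕ) + 1 < p.1 ∧ x = braidGen i},
            ∃ ε : ℤ, (ε = 1 ∨ ε = -1) ∧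
              α j = β * (braidGen ⟨p.1 - 1, by have := p.isLt; omega⟩) ^ ε * γ ∧
              ((ρ j).IsSwap → γ = β⁻¹)) := by
  choose L hL1 hL2 hL3 using fun j => exists_swapProd_eq n (ρ j)
    (fun q hq => absurd q.isLt (by omega))
  have hone : (1 : BraidGroup n) ∈ thinProd pr (List.ofFn L).flatten := by
    refine one_mem_thinProd hpr n _ ?_ ?_
    · intro p hp
      obtain ⟨l, hl, hp⟩ := List.mem_flatten.1 hp
      obtain ⟨j, rfl⟩ := List.mem_ofFn.1 hl
      exact hL1 j p hp
    · rw [swapProd_flatten, List.map_ofFn, ← hρ]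
      congr 2
      exact funext hL3
  rw [thinProd_flatten, List.map_ofFn, Set.mem_prod_list_ofFn] at hone
  obtain ⟨α, hα⟩ := hone
  refine ⟨fun j => α j, hα, fun j => ?_, fun j hj p hp => ?_⟩
  · rw [← hL3 j]
    exact map_of_mem_thinProd (α j).2
  · have ha := (α j).2
    have h1 := hL1 j
    have h2 := hL2 j
    have h3 := hL3 j
    dsimp only
    generalize (α j : BraidGroup n) = a at ha ⊢
    rw [Function.comp_apply] at ha
    generalize L j = l at h1 h2 h3 ha
    rcases l with _ | ⟨⟨c, k⟩, l⟩
    · exact absurd h3.symm hj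
    rw [List.forall_mem_cons] at h1
    rw [List.pairwise_cons] at h2
    have hl : ∀ p ∈ l, p.1 < p.2 ∧ p.2 < k := fun p hp => ⟨(h1.2 p hp).1, h2.1 p hp⟩
    have hck : c < k := h1.1.1
    have hρk : ρ j k = c := by rw [← h3, swapProd_cons_apply hl]
    obtain rfl : k = p := by
      refine le_antisymm (hp.2 k (by rw [hρk]; exact hck.ne)) ?_
      by_contra! hlt
      refine hp.1 ?_
      rw [← h3]
      refine swapProd_apply_of_le (m := k.1 + 1) ?_ hlt
      rw [List.forall_mem_cons]
      exact ⟨⟨hck, Nat.lt_succ_self _⟩, fun q hq => ⟨(hl q hq).1, Nat.lt_succ_of_lt (hl q hq).2⟩⟩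
    have hck' : c.1 < k.1 := hck
    rw [thinProd_cons] at ha
    obtain ⟨A, ⟨⟨β, hβ, ε, hε, rfl⟩, -⟩, d, hd, rfl⟩ := ha
    refine ⟨by omega, β, hβ, β⁻¹ * d, mul_mem (inv_mem hβ) (thinProd_mem_lower hl hd), ε, hε, ?_,
      fun hsw => ?_⟩
    · simp only
      rw [gen, dif_pos (by have := k.isLt; omega), mul_assoc _ β⁻¹ d]
    · have hl0 : swapProd l = 1 := by
        obtain ⟨x, y, hxy, he⟩ := hsw
        have hs : ρ j = Equiv.swap c k := by
          have hk : Equiv.swap x y k ≠ k := by rw [← he, hρk]; exact hck.ne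
          rw [← hρk, he]
          rcases Equiv.swap_apply_ne_self_iff.1 hk with ⟨-, rfl | rfl⟩
          · rw [Equiv.swap_apply_left, Equiv.swap_comm]
          · rw [Equiv.swap_apply_right]
        rw [hs, swapProd_cons] at h3
        exact mul_eq_left.1 h3
      rcases l with _ | ⟨⟨c', k'⟩, l⟩
      · simp only [thinProd_nil, Set.mem_one] at hd
        rw [hd, mul_one]
      · rw [List.forall_mem_cons] at hl
        rw [List.pairwise_cons] at h2
        have := swapProd_cons_apply (c := c') (k := k') (l := l)
          fun p hp => ⟨(hl.2 p hp).1, h2.2.1 p hp⟩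
        rw [hl0, Equiv.Perm.one_apply] at this
        exact absurd this hl.1.1.ne'
end

section
/- Let n ≥ 2 and m ≥ 1, and let (ρ₁, …, ρ_m) be a tuple of transpositions in S_n with ρ₁ρ₂⋯ρ_m = 1. Then there exists a tuple (α₁, …, α_m) of elements of the braid group B_n with α₁α₂⋯α_m = 1, with π(α_j) = ρ_j for every j, and such that each α_j is conjugate in B_n to σ₁ or to σ₁^{−1}. -/
/-- `l` lifts along `f` to a list of elements of `S` with product `β`. -/
def LiftsTo {G H : Type*} [Group G] [Group H] (f : G →* H) (S : Set G)
    (l : List H) (β : G) : Prop :=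
  ∃ as : List G, (∀ a ∈ as, a ∈ S) ∧ as.map f = l ∧ as.prod = β

namespace LiftsTo

variable {G H : Type*} [Group G] [Group H] {f : G →* H} {S : Set G}

theorem cons_iff {x : H} {l : List H} {β : G} :
    LiftsTo f S (x :: l) β ↔ ∃ a ∈ S, f a = x ∧ ∃ γ, LiftsTo f S l γ ∧ a * γ = β := by
  constructor
  · rintro ⟨as, hS, hf, hp⟩
    cases as with
    | nil => simp at hf
    | cons a as =>
      simp only [List.map_cons, List.cons.injEq] at hf
      exact ⟨a, hS a (by simp), hf.1, as.prod,
        ⟨as, fun b hb => hS b (by simp [hb]), hf.2, rfl⟩, by simpa using hp⟩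
  · rintro ⟨a, ha, rfl, γ, ⟨as, hS, rfl, rfl⟩, rfl⟩
    exact ⟨a :: as, by simpa using ⟨ha, hS⟩, by simp, by simp⟩

theorem cons_mono {x : H} {l l' : List H}
    (h : ∀ β, LiftsTo f S l β → LiftsTo f S l' β) (β : G)
    (hl : LiftsTo f S (x :: l) β) : LiftsTo f S (x :: l') β := by
  obtain ⟨a, ha, hx, γ, hγ, hβ⟩ := cons_iff.1 hl
  exact cons_iff.2 ⟨a, ha, hx, γ, h γ hγ, hβ⟩

/-- Undoing the Hurwitz move `(x, y) ↦ (y, y⁻¹xy)`. -/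
theorem of_hurwitz_right (hS : ∀ a ∈ S, ∀ g, g * a * g⁻¹ ∈ S) {x y : H} {l : List H} {β : G}
    (h : LiftsTo f S (y :: (y⁻¹ * x * y) :: l) β) : LiftsTo f S (x :: y :: l) β := by
  obtain ⟨a, ha, rfl, γ, hγ, rfl⟩ := cons_iff.1 h
  obtain ⟨b, hb, hy, δ, hδ, rfl⟩ := cons_iff.1 hγ
  exact cons_iff.2 ⟨a * b * a⁻¹, hS b hb a, by simp [hy, mul_assoc], a * δ,
    cons_iff.2 ⟨a, ha, rfl, δ, hδ, rfl⟩, by group⟩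

/-- Undoing the Hurwitz move `(x, y) ↦ (xyx⁻¹, x)`. -/
theorem of_hurwitz_left (hS : ∀ a ∈ S, ∀ g, g * a * g⁻¹ ∈ S) {x y : H} {l : List H} {β : G}
    (h : LiftsTo f S ((x * y * x⁻¹) :: x :: l) β) : LiftsTo f S (x :: y :: l) β := by
  obtain ⟨a, ha, hx, γ, hγ, rfl⟩ := cons_iff.1 h
  obtain ⟨b, hb, rfl, δ, hδ, rfl⟩ := cons_iff.1 hγ
  refine cons_iff.2 ⟨b, hb, rfl, b⁻¹ * a * b * δ,
    cons_iff.2 ⟨b⁻¹ * a * b, by simpa using hS a ha b⁻¹, by simp [hx, mul_assoc], δ, hδ, rfl⟩, ?_⟩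
  group

/-- A list of transpositions whose product sends `a` to `b ≠ a` can be brought by Hurwitz moves
to a list starting with `swap a b`. -/
theorem exists_cons_swap {X : Type*} [DecidableEq X] {f : G →* Equiv.Perm X}
    (hS : ∀ a ∈ S, ∀ g, g * a * g⁻¹ ∈ S) (a : X) (l : List (Equiv.Perm X))
    (hl : ∀ x ∈ l, x.IsSwap) (b : X) (hb : l.prod a = b) (hab : a ≠ b) :
    ∃ l' : List (Equiv.Perm X), (∀ x ∈ l', x.IsSwap) ∧ l'.length + 1 = l.length ∧
      Equiv.swap a b * l'.prod = l.prod ∧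
      ∀ β, LiftsTo f S (Equiv.swap a b :: l') β → LiftsTo f S l β := by
  induction l generalizing b with
  | nil => simp at hb; exact absurd hb hab
  | cons x l ih =>
    have hx : x.IsSwap := hl x (by simp)
    have hl' : ∀ y ∈ l, y.IsSwap := fun y hy => hl y (by simp [hy])
    replace hb : x (l.prod a) = b := by simpa using hb
    obtain ⟨c, hc⟩ : ∃ c, l.prod a = c := ⟨_, rfl⟩
    rw [hc] at hb
    by_cases hcb : c = b
    · subst hcb
      obtain ⟨l', h1, h2, h3, h4⟩ := ih hl' c hc hab
      refine ⟨((Equiv.swap a c)⁻¹ * x * Equiv.swap a c) :: l', ?_, by simp [h2], ?_, fun β h =>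
        cons_mono h4 β (of_hurwitz_right hS h)⟩
      · intro y hy
        rcases List.mem_cons.1 hy with rfl | hy
        · obtain ⟨p, q, hpq, rfl⟩ := hx
          refine ⟨(Equiv.swap a c)⁻¹ p, (Equiv.swap a c)⁻¹ q, by simpa using hpq, ?_⟩
          rw [Equiv.swap_apply_apply, inv_inv]
        · exact h1 y hy
      · rw [List.prod_cons, List.prod_cons, ← h3]
        group
    · have hxs : x = Equiv.swap c b := by
        obtain ⟨p, q, hpq, rfl⟩ := hx
        have hne : Equiv.swap p q c ≠ c := by rw [hb]; exact Ne.symm hcb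
        rcases (Equiv.swap_apply_ne_self_iff.1 hne).2 with rfl | rfl
        · rw [Equiv.swap_apply_left] at hb; rw [hb]
        · rw [Equiv.swap_apply_right] at hb; rw [hb, Equiv.swap_comm]
      by_cases hca : c = a
      · subst hca
        exact ⟨l, hl', by simp, by simp [hxs], fun β h => hxs ▸ h⟩
      · obtain ⟨l', h1, h2, h3, h4⟩ := ih hl' c hc (Ne.symm hca)
        have hconj : x * Equiv.swap a c * x⁻¹ = Equiv.swap a b := by
          rw [← Equiv.swap_apply_apply, hb, hxs, Equiv.swap_apply_of_ne_of_ne (Ne.symm hca) hab]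
        refine ⟨x :: l', by simpa using ⟨hx, h1⟩, by simp [h2], ?_, fun β h =>
          cons_mono h4 β (of_hurwitz_left hS (hconj ▸ h))⟩
        rw [List.prod_cons, List.prod_cons, ← h3, ← hconj]
        group

/-- A list of transpositions with product `1` lifts to a list in `S` with product `1`, provided
`S` is closed under conjugation and inversion and every transposition lifts to `S`. -/
theorem of_prod_eq_one {X : Type*} [DecidableEq X] {f : G →* Equiv.Perm X}
    (hS : ∀ a ∈ S, ∀ g, g * a * g⁻¹ ∈ S) (hinv : ∀ a ∈ S, a⁻¹ ∈ S)
    (hsurj : ∀ x : Equiv.Perm X, x.IsSwap → ∃ a ∈ S, f a = x) (l : List (Equiv.Perm X))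
    (hl : ∀ x ∈ l, x.IsSwap) (hprod : l.prod = 1) : LiftsTo f S l 1 := by
  induction hk : l.length using Nat.strong_induction_on generalizing l with
  | _ k ih =>
    cases l with
    | nil => exact ⟨[], by simp, rfl, rfl⟩
    | cons x l =>
      obtain ⟨a, b, hab, rfl⟩ := hl x (by simp)
      rw [List.prod_cons, mul_eq_one_iff_inv_eq, Equiv.swap_inv] at hprod
      obtain ⟨l', h1, h2, h3, h4⟩ := exists_cons_swap (f := f) hS a l
        (fun y hy => hl y (by simp [hy])) b (by rw [← hprod, Equiv.swap_apply_left]) hab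
      rw [← hprod, mul_eq_left] at h3
      obtain ⟨s, hs, hfs⟩ := hsurj _ (hl (Equiv.swap a b) (by simp))
      refine cons_mono h4 1 (cons_iff.2 ⟨s, hs, hfs, s⁻¹, cons_iff.2 ⟨s⁻¹, hinv s hs, ?_, 1,
        ih l'.length ?_ l' h1 h3 rfl, mul_one _⟩, mul_inv_cancel s⟩)
      · rw [map_inv, hfs, Equiv.swap_inv]
      · simp only [List.length_cons] at hk
        omega

end LiftsTo

theorem surjective_of_map_braidGen {n : ℕ} (pr : BraidGroup n →* Equiv.Perm (Fin n))
    (hpr : ∀ i : Fin (n - 1), pr (braidGen i) = Equiv.swap (finLow i) (finHigh i)) :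
    Function.Surjective pr := by
  cases n with
  | zero => exact fun x => ⟨1, Subsingleton.elim _ _⟩
  | succ n =>
    rw [← MonoidHom.mrange_eq_top, eq_top_iff, ← Equiv.Perm.mclosure_swap_castSucc_succ n,
      Submonoid.closure_le]
    rintro _ ⟨i, rfl⟩
    exact ⟨braidGen i, hpr i⟩

/-- Every transposition system in `S_n` (tuple of transpositions with
product the identity) lifts to a simple braid system: a tuple of braids with product `1`,
projecting to the given transpositions, each conjugate in `B_n` to `σ₁` or `σ₁⁻¹`. -/
theorem transposition_system_lifts_to_simple_braid_system
    (n m : ℕ) (hn : 2 ≤ n) (hm : 1 ≤ m)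
    (pr : BraidGroup n →* Equiv.Perm (Fin n))
    (hpr : ∀ i : Fin (n - 1), pr (braidGen i) = Equiv.swap (finLow i) (finHigh i))
    (ρ : Fin m → Equiv.Perm (Fin n))
    (hswap : ∀ j, (ρ j).IsSwap)
    (hρ : (List.ofFn ρ).prod = 1) :
    ∃ α : Fin m → BraidGroup n,
      (List.ofFn α).prod = 1 ∧
      (∀ j, pr (α j) = ρ j) ∧
      (∀ j, IsConj (braidGen (⟨0, by omega⟩ : Fin (n - 1))) (α j) ∨
            IsConj (braidGen (⟨0, by omega⟩ : Fin (n - 1)))⁻¹ (α j)) := by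
  set σ : BraidGroup n := braidGen (⟨0, by omega⟩ : Fin (n - 1)) with hσ
  have hσswap : (pr σ).IsSwap := ⟨_, _, by simp [finLow, finHigh, Fin.ext_iff], hpr _⟩
  obtain ⟨as, hS, hmap, hprod⟩ : LiftsTo pr {a | IsConj σ a ∨ IsConj σ⁻¹ a} (List.ofFn ρ) 1 := by
    refine LiftsTo.of_prod_eq_one ?_ ?_ ?_ _ (by simpa [List.mem_ofFn] using hswap) hρ
    · exact fun a ha g => ha.imp (fun h => h.trans (isConj_iff.2 ⟨g, rfl⟩))
        (fun h => h.trans (isConj_iff.2 ⟨g, rfl⟩))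
    · have hinv : ∀ a b : BraidGroup n, IsConj a b → IsConj a⁻¹ b⁻¹ := by
        intro a b h
        obtain ⟨c, rfl⟩ := isConj_iff.1 h
        exact isConj_iff.2 ⟨c, by group⟩
      rintro a (h | h)
      · exact Or.inr (hinv _ _ h)
      · exact Or.inl (by simpa using hinv _ _ h)
    · intro x hx
      obtain ⟨p, q, hpq, hσ'⟩ := hσswap
      obtain ⟨r, s, hrs, rfl⟩ := hx
      obtain ⟨g, hg⟩ := isConj_iff.1 (Equiv.Perm.isConj_swap hpq hrs)
      obtain ⟨γ, rfl⟩ := surjective_of_map_braidGen pr hpr g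
      exact ⟨γ * σ * γ⁻¹, Or.inl (isConj_iff.2 ⟨γ, rfl⟩), by simp [hσ', ← hg]⟩
  obtain rfl : as.length = m := by simpa using congrArg List.length hmap
  refine ⟨as.get, by rw [List.ofFn_get, hprod], fun j => ?_, fun j => hS _ (List.get_mem as j)⟩
  have h : List.ofFn (pr ∘ as.get) = List.ofFn ρ := by
    rw [← List.map_ofFn, List.ofFn_get, hmap]
  exact congrFun (List.ofFn_injective h) j
end

section
/- Let K be the fundamental group of the Klein bottle, presented as K = ⟨a, b ∣ a²b² = 1⟩. Then there exists a group homomorphism φ : K → ℤ such that φ(a) and φ(b) are both odd integers. -/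
/-- The single relator `a·a·b·b` of the Klein bottle group. -/
def kleinRels : Set (FreeGroup (Fin 2)) :=
  {FreeGroup.of 0 * FreeGroup.of 0 * FreeGroup.of 1 * FreeGroup.of 1}

/-- The fundamental group of the Klein bottle, `K = ⟨a, b ∣ a²b² = 1⟩`. -/
abbrev KleinGroup : Type := PresentedGroup kleinRels

/-- There is a homomorphism from the Klein bottle group to `ℤ`
sending both generators to odd integers (the braid monodromy, via `B₂ ≅ ℤ`, lifting the
monodromy `a ↦ (12), b ↦ (12)` of the orientation double cover of the torus). -/
theorem klein_orientation_cover_lifts :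
    ∃ φ : KleinGroup →* Multiplicative ℤ,
      Odd (Multiplicative.toAdd (φ (PresentedGroup.of 0))) ∧
      Odd (Multiplicative.toAdd (φ (PresentedGroup.of 1))) := by
  let f : Fin 2 → Multiplicative ℤ := ![Multiplicative.ofAdd 1, Multiplicative.ofAdd (-1)]
  have hf : ∀ r ∈ kleinRels, FreeGroup.lift f r = 1 := by
    rintro r rfl
    simp [f]
  refine ⟨PresentedGroup.toGroup hf, ?_, ?_⟩
  · rw [PresentedGroup.toGroup.of]
    exact odd_one
  · rw [PresentedGroup.toGroup.of]
    exact odd_one.neg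
end

section
/- There do not exist elements α, β of the braid group B₄ with π(α) the transposition (1 2), π(β) the transposition (3 4), and α² = β². -/
/-- Two actions of a presented group are intertwined by `f` as soon as their generators are. -/
theorem PresentedGroup.map_perm_apply_of_forall_of {ι X Y : Type*} {rels : Set (FreeGroup ι)}
    (φ : PresentedGroup rels →* Equiv.Perm X) (ψ : PresentedGroup rels →* Equiv.Perm Y) (f : X → Y)
    (h : ∀ i x, f (φ (.of i) x) = ψ (.of i) (f x)) (g : PresentedGroup rels) (x : X) :
    f (φ g x) = ψ g (f x) := by
  have hg : g ∈ Subgroup.closure (Set.range (PresentedGroup.of (rels := rels))) := by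
    rw [PresentedGroup.closure_range_of]; trivial
  induction hg using Subgroup.closure_induction generalizing x with
  | mem _ hy => obtain ⟨i, rfl⟩ := hy; exact h i x
  | one => simp
  | mul _ _ _ _ ha hb => simp [ha, hb]
  | inv a _ ha =>
    apply (ψ a).injective
    simp [← ha]

/-- The action of an elementary crossing on ordered pairs of strands decorated with a crossing
count modulo `4`: the positions are permuted, and the count goes up by one when the two strands
of the pair cross each other. -/
def crossingPerm (i : Fin 3) : Equiv.Perm (Fin 4 × Fin 4 × ZMod 4) :=
  let s := Equiv.swap i.castSucc i.succ
  { toFun := fun x => (s x.1, s x.2.1, x.2.2 + if x.1 ≠ x.2.1 ∧ s x.1 = x.2.1 then 1 else 0)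
    invFun := fun x => (s x.1, s x.2.1, x.2.2 - if x.1 ≠ x.2.1 ∧ s x.1 = x.2.1 then 1 else 0)
    left_inv := fun x => by
      have h : s x.1 = x.2.1 ↔ x.1 = s x.2.1 := by
        rw [← s.injective.eq_iff, Equiv.swap_apply_self]
      simp [s, h]
    right_inv := fun x => by
      have h : s x.1 = x.2.1 ↔ x.1 = s x.2.1 := by
        rw [← s.injective.eq_iff, Equiv.swap_apply_self]
      simp [s, h] }

theorem crossingPerm_mul_comm : ∀ i j : Fin 3, (i : ℕ) + 2 ≤ j →
    ∀ x, (crossingPerm i * crossingPerm j) x = (crossingPerm j * crossingPerm i) x := by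
  decide +kernel

theorem crossingPerm_braid : ∀ i j : Fin 3, (i : ℕ) + 1 = j →
    ∀ x, (crossingPerm i * crossingPerm j * crossingPerm i) x =
      (crossingPerm j * crossingPerm i * crossingPerm j) x := by
  decide +kernel

/-- The action of the braid group `B₄` on ordered pairs of strands decorated with a crossing count
modulo `4`. -/
def crossingHom : BraidGroup 4 →* Equiv.Perm (Fin 4 × Fin 4 × ZMod 4) :=
  PresentedGroup.toGroup (f := crossingPerm) <| by
    rintro r (⟨i, j, hij, rfl⟩ | ⟨i, j, hij, rfl⟩)
    · simp only [map_mul, map_inv, FreeGroup.lift_apply_of]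
      rw [mul_inv_eq_one, mul_inv_eq_iff_eq_mul]
      exact Equiv.ext (crossingPerm_mul_comm i j hij)
    · simp only [map_mul, map_inv, FreeGroup.lift_apply_of]
      rw [mul_inv_eq_one]
      exact Equiv.ext (crossingPerm_braid i j hij)

theorem crossingHom_of (i : Fin 3) : crossingHom (PresentedGroup.of i) = crossingPerm i :=
  PresentedGroup.toGroup.of _

/-- Whether the crossing count is even, corrected by the order of the two strands. -/
def crossingParity (x : Fin 4 × Fin 4 × ZMod 4) : Bool :=
  (decide (x.1 < x.2.1)).xor (decide (Even x.2.2.val))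

theorem crossingHom_add_count (g : BraidGroup 4) (a b : Fin 4) (k l : ZMod 4) :
    crossingHom g (a, b, k + l) =
      ((crossingHom g (a, b, k)).1, (crossingHom g (a, b, k)).2.1,
        (crossingHom g (a, b, k)).2.2 + l) := by
  refine (PresentedGroup.map_perm_apply_of_forall_of crossingHom crossingHom
    (fun x => (x.1, x.2.1, x.2.2 + l)) (fun i x => ?_) g (a, b, k)).symm
  simp only [crossingHom_of, crossingPerm, Equiv.coe_fn_mk, add_right_comm]

theorem crossingHom_swap (g : BraidGroup 4) (a b : Fin 4) (k : ZMod 4) :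
    crossingHom g (b, a, k) =
      ((crossingHom g (a, b, k)).2.1, (crossingHom g (a, b, k)).1,
        (crossingHom g (a, b, k)).2.2) := by
  refine (PresentedGroup.map_perm_apply_of_forall_of crossingHom crossingHom
    (fun x => (x.2.1, x.1, x.2.2)) (fun i x => ?_) g (a, b, k)).symm
  simp only [crossingHom_of]
  revert i x
  decide +kernel

theorem crossingParity_crossingHom (g : BraidGroup 4) (x : Fin 4 × Fin 4 × ZMod 4) :
    crossingParity (crossingHom g x) = crossingParity x := by
  refine PresentedGroup.map_perm_apply_of_forall_of crossingHom 1 crossingParity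
    (fun i x => ?_) g x
  simp only [crossingHom_of, MonoidHom.one_apply, Equiv.Perm.one_apply]
  revert i x
  decide +kernel

theorem crossingHom_apply_eq (pr : BraidGroup 4 →* Equiv.Perm (Fin 4))
    (hpr : ∀ i : Fin (4 - 1), pr (braidGen i) = Equiv.swap (finLow i) (finHigh i))
    (g : BraidGroup 4) (a b : Fin 4) (k : ZMod 4) :
    crossingHom g (a, b, k) = (pr g a, pr g b, (crossingHom g (a, b, k)).2.2) := by
  have h₁ := PresentedGroup.map_perm_apply_of_forall_of crossingHom pr Prod.fst
    (fun i x => by rw [crossingHom_of]; exact (congrArg (· x.1) (hpr i)).symm) g (a, b, k)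
  have h₂ := PresentedGroup.map_perm_apply_of_forall_of crossingHom pr (fun x => x.2.1)
    (fun i x => by rw [crossingHom_of]; exact (congrArg (· x.2.1) (hpr i)).symm) g (a, b, k)
  exact Prod.ext h₁ (Prod.ext h₂ rfl)

/-- There are no braids `α, β ∈ B₄` with `π(α) = (1 2)`, `π(β) = (3 4)`
(0-based: `swap 0 1` and `swap 2 3`) and `α² = β²`. -/
theorem no_equal_squares_over_disjoint_transpositions
    (pr : BraidGroup 4 →* Equiv.Perm (Fin 4))
    (hpr : ∀ i : Fin (4 - 1), pr (braidGen i) = Equiv.swap (finLow i) (finHigh i)) :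
    ¬ ∃ α β : BraidGroup 4,
        pr α = Equiv.swap (0 : Fin 4) 1 ∧
        pr β = Equiv.swap (2 : Fin 4) 3 ∧
        α ^ 2 = β ^ 2 := by
  rintro ⟨α, β, hα, hβ, h⟩
  obtain ⟨k, hk⟩ : ∃ k, crossingHom α (0, 1, 0) = (1, 0, k) :=
    ⟨_, by simpa [hα] using crossingHom_apply_eq pr hpr α 0 1 0⟩
  obtain ⟨l, hl⟩ : ∃ l, crossingHom β (0, 1, 0) = (0, 1, l) :=
    ⟨_, by simpa [hβ, Equiv.swap_apply_of_ne_of_ne] using crossingHom_apply_eq pr hpr β 0 1 0⟩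
  have hα₂ : crossingHom (α ^ 2) (0, 1, 0) = (0, 1, k + k) := by
    have hk' : crossingHom α (1, 0, 0) = (0, 1, k) := by rw [crossingHom_swap, hk]
    have := crossingHom_add_count α 1 0 0 k
    rw [zero_add, hk'] at this
    rw [pow_two, map_mul, Equiv.Perm.mul_apply, hk, this]
  have hβ₂ : crossingHom (β ^ 2) (0, 1, 0) = (0, 1, l + l) := by
    have := crossingHom_add_count β 0 1 0 l
    rw [zero_add, hl] at this
    rw [pow_two, map_mul, Equiv.Perm.mul_apply, hl, this]
  have hkl : k + k = l + l := by
    rw [h, hβ₂] at hα₂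
    simpa using hα₂.symm
  have hk_par := crossingParity_crossingHom α (0, 1, 0)
  have hl_par := crossingParity_crossingHom β (0, 1, 0)
  rw [hk] at hk_par
  rw [hl] at hl_par
  clear hα₂ hβ₂ hk hl
  revert k l
  decide +kernel
end

section
/- There exist elements α, β of the braid group B₉ with π(α) equal to the permutation (1 7 2 8 3 9)(4 6 5), π(β) equal to the permutation (1 3 2)(4 7 5 8 6 9), and α² = β². (Here both permutations square to (1 2 3)(4 5 6)(7 8 9).) -/
/-- A sequence in a group whose first `m` terms satisfy the braid relations. -/
structure IsBraidSeq {G : Type*} [Group G] (m : ℕ) (s : ℕ → G) : Prop where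
  comm : ∀ i j, i + 2 ≤ j → j < m → Commute (s i) (s j)
  braid : ∀ i, i + 1 < m → s i * s (i + 1) * s i = s (i + 1) * s i * s (i + 1)

/-- The triple crossing exchanging the strands `i, i + 1, i + 2` with the strands
`i + 3, i + 4, i + 5`. -/
def tripleCross {G : Type*} [Group G] (s : ℕ → G) (i : ℕ) : G :=
  s (i + 2) * s (i + 3) * s (i + 4) * (s (i + 1) * s (i + 2) * s (i + 3)) *
    (s i * s (i + 1) * s (i + 2))

namespace IsBraidSeq

variable {G : Type*} [Group G] {m : ℕ} {s : ℕ → G}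

theorem commute_of_far (h : IsBraidSeq m s) {i j : ℕ} (hi : i < m) (hj : j < m)
    (hij : i + 2 ≤ j ∨ j + 2 ≤ i) : Commute (s i) (s j) :=
  hij.elim (fun H => h.comm i j H hj) (fun H => (h.comm j i H hi).symm)

theorem semiconj_up (h : IsBraidSeq m s) (i : ℕ) (hi : i + 1 < m) :
    SemiconjBy (s i * s (i + 1)) (s i) (s (i + 1)) := by
  rw [SemiconjBy, h.braid i hi, mul_assoc]

theorem semiconj_down (h : IsBraidSeq m s) (i : ℕ) (hi : i + 1 < m) :
    SemiconjBy (s (i + 1) * s i) (s (i + 1)) (s i) := by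
  rw [SemiconjBy, ← h.braid i hi, mul_assoc]

theorem row_semiconj_first (h : IsBraidSeq m s) (i : ℕ) (hi : i + 2 < m) :
    SemiconjBy (s i * s (i + 1) * s (i + 2)) (s i) (s (i + 1)) :=
  (h.semiconj_up i (by omega)).mul_left (h.commute_of_far (by omega) (by omega) (by omega))

theorem row_semiconj_second (h : IsBraidSeq m s) (i : ℕ) (hi : i + 2 < m) :
    SemiconjBy (s i * s (i + 1) * s (i + 2)) (s (i + 1)) (s (i + 2)) := by
  rw [mul_assoc]
  exact SemiconjBy.mul_left (h.commute_of_far (by omega) (by omega) (by omega))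
    (h.semiconj_up (i + 1) (by omega))

theorem column_semiconj_second (h : IsBraidSeq m s) (i : ℕ) (hi : i + 2 < m) :
    SemiconjBy (s (i + 2) * s (i + 1) * s i) (s (i + 1)) (s i) := by
  rw [mul_assoc]
  exact SemiconjBy.mul_left (h.commute_of_far (by omega) (by omega) (by omega))
    (h.semiconj_down i (by omega))

theorem column_semiconj_third (h : IsBraidSeq m s) (i : ℕ) (hi : i + 2 < m) :
    SemiconjBy (s (i + 2) * s (i + 1) * s i) (s (i + 2)) (s (i + 1)) :=
  (h.semiconj_down (i + 1) (by omega)).mul_left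
    (h.commute_of_far (by omega) (by omega) (by omega))

theorem tripleCross_eq_columns (h : IsBraidSeq m s) (i : ℕ) (hi : i + 4 < m) :
    tripleCross s i = s (i + 2) * s (i + 1) * s i * (s (i + 3) * s (i + 2) * s (i + 1)) *
      (s (i + 4) * s (i + 3) * s (i + 2)) := by
  have h31 : Commute (s (i + 3)) (s (i + 1)) := h.commute_of_far (by omega) (by omega) (by omega)
  have h30 : Commute (s (i + 3)) (s i) := h.commute_of_far (by omega) (by omega) (by omega)
  have h41 : Commute (s (i + 4)) (s (i + 1)) := h.commute_of_far (by omega) (by omega) (by omega)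
  have h42 : Commute (s (i + 4)) (s (i + 2)) := h.commute_of_far (by omega) (by omega) (by omega)
  have h40 : Commute (s (i + 4)) (s i) := h.commute_of_far (by omega) (by omega) (by omega)
  have h20 : Commute (s (i + 2)) (s i) := h.commute_of_far (by omega) (by omega) (by omega)
  simp only [tripleCross, mul_assoc]
  rw [h41.left_comm, h31.left_comm, h42.left_comm, h30.left_comm, h40.left_comm, h20.left_comm,
    h30.left_comm, h31.left_comm, h41.left_comm]

theorem tripleCross_semiconj_add_three (h : IsBraidSeq m s) (i : ℕ) (hi : i + 4 < m) :
    SemiconjBy (tripleCross s i) (s i) (s (i + 3)) ∧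
      SemiconjBy (tripleCross s i) (s (i + 1)) (s (i + 4)) :=
  ⟨((h.row_semiconj_first (i + 2) (by omega)).mul_left
      (h.row_semiconj_first (i + 1) (by omega))).mul_left (h.row_semiconj_first i (by omega)),
    ((h.row_semiconj_second (i + 2) (by omega)).mul_left
      (h.row_semiconj_second (i + 1) (by omega))).mul_left (h.row_semiconj_second i (by omega))⟩

theorem tripleCross_semiconj_sub_three (h : IsBraidSeq m s) (i : ℕ) (hi : i + 4 < m) :
    SemiconjBy (tripleCross s i) (s (i + 3)) (s i) ∧
      SemiconjBy (tripleCross s i) (s (i + 4)) (s (i + 1)) := by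
  rw [h.tripleCross_eq_columns i hi]
  exact ⟨((h.column_semiconj_second i (by omega)).mul_left
      (h.column_semiconj_second (i + 1) (by omega))).mul_left
        (h.column_semiconj_second (i + 2) (by omega)),
    ((h.column_semiconj_third i (by omega)).mul_left
      (h.column_semiconj_third (i + 1) (by omega))).mul_left
        (h.column_semiconj_third (i + 2) (by omega))⟩

theorem tripleCross_commute_of_far (h : IsBraidSeq m s) (i j : ℕ) (hi : i + 4 < m) (hj : j < m)
    (hij : j + 2 ≤ i ∨ i + 6 ≤ j) : Commute (tripleCross s i) (s j) := by
  have key : ∀ k, k ≤ 4 → Commute (s (i + k)) (s j) := fun k hk =>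
    h.commute_of_far (by omega) (by omega) (by omega)
  have h0 := key 0 (by omega)
  have h1 := key 1 (by omega)
  have h2 := key 2 (by omega)
  have h3 := key 3 (by omega)
  have h4 := key 4 (by omega)
  exact (((h2.mul_left h3).mul_left h4).mul_left ((h1.mul_left h2).mul_left h3)).mul_left
    ((h0.mul_left h1).mul_left h2)

/-- A product of two triple crossings shifts the generator crossing the first two blocks. -/
theorem tripleCross_mul_semiconj_middle (h : IsBraidSeq m s) (i : ℕ) (hi : i + 7 < m) :
    SemiconjBy (tripleCross s i * tripleCross s (i + 3)) (s (i + 2)) (s (i + 5)) := by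
  have far : ∀ a b, a < 8 → b < 8 → a + 2 ≤ b ∨ b + 2 ≤ a → Commute (s (i + a)) (s (i + b)) :=
    fun a b ha hb hab => h.commute_of_far (by omega) (by omega) (by omega)
  have rows : ∀ a b, a + 4 ≤ b → b + 2 < 8 →
      Commute (s (i + a) * s (i + (a + 1)) * s (i + (a + 2)))
        (s (i + b) * s (i + (b + 1)) * s (i + (b + 2))) := fun a b hab hb => by
    refine Commute.mul_left (Commute.mul_left ?_ ?_) ?_ <;>
      refine Commute.mul_right (Commute.mul_right ?_ ?_) ?_ <;> apply far <;> omega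
  have step : ∀ a, a + 5 < 8 →
      SemiconjBy (s (i + a) * s (i + (a + 1)) * s (i + (a + 2)) *
          (s (i + (a + 3)) * s (i + (a + 4)) * s (i + (a + 5))))
        (s (i + (a + 2))) (s (i + (a + 3))) := fun a ha => by
    have hmid : SemiconjBy (s (i + (a + 2)) * s (i + (a + 3))) (s (i + (a + 2)))
        (s (i + (a + 3))) := h.semiconj_up (i + (a + 2)) (by omega)
    have hr := (far (a + 4) (a + 2) (by omega) (by omega) (by omega)).mul_left
      (far (a + 5) (a + 2) (by omega) (by omega) (by omega))
    have hl := (far a (a + 3) (by omega) (by omega) (by omega)).mul_left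
      (far (a + 1) (a + 3) (by omega) (by omega) (by omega))
    simpa only [mul_assoc] using (SemiconjBy.mul_left hl hmid).mul_left hr
  have hR := ((step 2 (by omega)).mul_left (step 1 (by omega))).mul_left (step 0 (by omega))
  have c04 := rows 0 4 (by omega) (by omega)
  have c05 := rows 0 5 (by omega) (by omega)
  have c15 := rows 1 5 (by omega) (by omega)
  simp only [Nat.zero_add, Nat.add_zero, Nat.reduceAdd] at hR c04 c05 c15
  refine (congrArg (SemiconjBy · (s (i + 2)) (s (i + 5))) ?_).mpr hR
  simp only [tripleCross, Nat.add_assoc, Nat.reduceAdd]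
  generalize s i * s (i + 1) * s (i + 2) = q0 at *
  generalize s (i + 1) * s (i + 2) * s (i + 3) = q1 at *
  generalize s (i + 2) * s (i + 3) * s (i + 4) = q2 at *
  generalize s (i + 3) * s (i + 4) * s (i + 5) = q3 at *
  generalize s (i + 4) * s (i + 5) * s (i + 6) = q4 at *
  generalize s (i + 5) * s (i + 6) * s (i + 7) = q5 at *
  simp only [mul_assoc]
  rw [c05.left_comm, c15.left_comm, c04.left_comm]

theorem tripleCross_braid (h : IsBraidSeq m s) (i : ℕ) (hi : i + 7 < m) :
    tripleCross s i * tripleCross s (i + 3) * tripleCross s i =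
      tripleCross s (i + 3) * tripleCross s i * tripleCross s (i + 3) := by
  have a0 := (h.tripleCross_semiconj_add_three i (by omega)).1.mul_left
    (h.tripleCross_commute_of_far (i + 3) i (by omega) (by omega) (by omega))
  have a1 := (h.tripleCross_semiconj_add_three i (by omega)).2.mul_left
    (h.tripleCross_commute_of_far (i + 3) (i + 1) (by omega) (by omega) (by omega))
  have a2 := h.tripleCross_mul_semiconj_middle i hi
  have a3 := SemiconjBy.mul_left
    (h.tripleCross_commute_of_far i (i + 6) (by omega) (by omega) (by omega))
    (h.tripleCross_semiconj_add_three (i + 3) (by omega)).1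
  have a4 := SemiconjBy.mul_left
    (h.tripleCross_commute_of_far i (i + 7) (by omega) (by omega) (by omega))
    (h.tripleCross_semiconj_add_three (i + 3) (by omega)).2
  have := ((((a2.mul_right a3).mul_right a4).mul_right ((a1.mul_right a2).mul_right a3)).mul_right
    ((a0.mul_right a1).mul_right a2)).eq
  rw [mul_assoc (tripleCross s (i + 3))]
  exact this

end IsBraidSeq

/-- If `D` exchanges `a` with `c` and fixes a square root `z` of `b`, where `g` exchanges `a` with
`b`, fixes `c` and commutes with `D ^ 2`, then `a * D * z` and its conjugate by `g` have equal
squares. -/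
theorem sq_eq_sq_conj {G : Type*} [Group G] {a b c z D g : G} (hb : z * z = b)
    (hza : Commute z a) (hab : Commute a b) (hbc : Commute b c)
    (hDa : SemiconjBy D a c) (hDz : Commute D z)
    (hga : SemiconjBy g a b) (hgb : SemiconjBy g b a) (hgc : Commute g c)
    (hgD : Commute g (D * D)) :
    (a * D * z) ^ 2 = (g * (a * D * z) * g⁻¹) ^ 2 := by
  have hsq : (a * D * z) ^ 2 = a * b * c * (D * D) := by
    calc (a * D * z) ^ 2 = a * D * (z * a) * (D * z) := by simp only [pow_two, mul_assoc]
      _ = a * (D * a) * (z * D) * z := by rw [hza.eq]; simp only [mul_assoc]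
      _ = a * c * D * D * (z * z) := by rw [hDa.eq, ← hDz.eq]; simp only [mul_assoc]
      _ = a * c * (D * D * b) := by rw [hb]; simp only [mul_assoc]
      _ = a * c * (b * (D * D)) := by
        rw [← hb, ((hDz.mul_right hDz).mul_left (hDz.mul_right hDz)).eq]
      _ = a * b * c * (D * D) := by rw [mul_assoc a b c, hbc.eq]; simp only [mul_assoc]
  have hcomm : Commute g ((a * D * z) ^ 2) := by
    rw [hsq]
    have h1 : SemiconjBy g (a * b) (b * a) := hga.mul_right hgb
    rw [← hab.eq] at h1
    exact Commute.mul_right (Commute.mul_right h1 hgc) hgD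
  rw [conj_pow, hcomm.eq, mul_inv_cancel_right]

/-- The Artin generators of `B₉`, extended by `1` outside the range of indices. -/
def braidSeqNine (i : ℕ) : BraidGroup 9 := if h : i < 8 then braidGen ⟨i, h⟩ else 1

theorem isBraidSeq_braidSeqNine : IsBraidSeq 8 braidSeqNine where
  comm i j hij hj := by
    have hi : i < 8 := by omega
    have hr : (PresentedGroup.mk (braidRels (9 - 1)) _ : BraidGroup 9) = 1 :=
      PresentedGroup.one_of_mem (Or.inl ⟨⟨i, hi⟩, ⟨j, hj⟩, hij, rfl⟩)
    simp only [map_mul, map_inv] at hr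
    rw [mul_inv_eq_one, mul_inv_eq_iff_eq_mul] at hr
    simp only [braidSeqNine, hi, hj, dif_pos]
    exact hr
  braid i hi := by
    have hlt : i < 8 := by omega
    have hr : (PresentedGroup.mk (braidRels (9 - 1)) _ : BraidGroup 9) = 1 :=
      PresentedGroup.one_of_mem (Or.inr ⟨⟨i, hlt⟩, ⟨i + 1, hi⟩, rfl, rfl⟩)
    simp only [map_mul, map_inv] at hr
    rw [mul_inv_eq_one] at hr
    simp only [braidSeqNine, hi, hlt, dif_pos]
    exact hr

/-- There are braids `α, β ∈ B₉` with `π(α) = (1 7 2 8 3 9)(4 6 5)`,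
`π(β) = (1 3 2)(4 7 5 8 6 9)` (written 0-based below via `List.formPerm`) and `α² = β²`. -/
theorem equal_squares_reducible_example_in_B9
    (pr : BraidGroup 9 →* Equiv.Perm (Fin 9))
    (hpr : ∀ i : Fin (9 - 1), pr (braidGen i) = Equiv.swap (finLow i) (finHigh i)) :
    ∃ α β : BraidGroup 9,
      pr α = ([0, 6, 1, 7, 2, 8] : List (Fin 9)).formPerm *
             ([3, 5, 4] : List (Fin 9)).formPerm ∧
      pr β = ([0, 2, 1] : List (Fin 9)).formPerm *
             ([3, 6, 4, 7, 5, 8] : List (Fin 9)).formPerm ∧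
      α ^ 2 = β ^ 2 := by
  have h := isBraidSeq_braidSeqNine
  have hs : ∀ (i : ℕ) (hi : i < 8), pr (braidSeqNine i) =
      Equiv.swap (⟨i, by omega⟩ : Fin 9) ⟨i + 1, by omega⟩ := fun i hi => by
    rw [braidSeqNine, dif_pos hi, hpr]
    rfl
  have hp0 : pr (tripleCross braidSeqNine 0) =
      Equiv.swap 0 3 * Equiv.swap 1 4 * Equiv.swap 2 5 := by
    simp only [tripleCross, map_mul, Nat.zero_add]
    simp (disch := omega) only [hs]
    decide +kernel
  have hp3 : pr (tripleCross braidSeqNine 3) =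
      Equiv.swap 3 6 * Equiv.swap 4 7 * Equiv.swap 5 8 := by
    simp only [tripleCross, map_mul, Nat.reduceAdd]
    simp (disch := omega) only [hs]
    decide +kernel
  set s := braidSeqNine
  have hg0 := h.tripleCross_semiconj_add_three 0 (by omega)
  have hg0r := h.tripleCross_semiconj_sub_three 0 (by omega)
  have hg3 := h.tripleCross_semiconj_add_three 3 (by omega)
  have hfar0 := fun j => h.tripleCross_commute_of_far 0 j (by omega)
  have hfar3 := fun j => h.tripleCross_commute_of_far 3 j (by omega)
  have hbraid := h.tripleCross_braid 0 (by omega)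
  simp only [Nat.zero_add, Nat.reduceAdd] at hg0 hg0r hg3 hfar0 hfar3 hbraid
  set g := tripleCross s 0
  set k := tripleCross s 3
  have hw : ∀ {x p q p₂ q₂ : BraidGroup 9}, SemiconjBy x p p₂ → SemiconjBy x q q₂ →
      SemiconjBy x (q * p * (q * p)) (q₂ * p₂ * (q₂ * p₂)) := fun hp hq =>
    (hq.mul_right hp).mul_right (hq.mul_right hp)
  have hcomm : ∀ {p q p₂ q₂ : BraidGroup 9}, Commute p p₂ → Commute p q₂ → Commute q p₂ →
      Commute q q₂ → Commute (q * p) (q₂ * p₂) := fun h1 h2 h3 h4 =>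
    (h4.mul_right h3).mul_left (h2.mul_right h1)
  have hAB : Commute (s 1 * s 0) (s 4 * s 3) := by
    apply hcomm <;> exact h.commute_of_far (by omega) (by omega) (by omega)
  have hBC : Commute (s 4 * s 3) (s 7 * s 6) := by
    apply hcomm <;> exact h.commute_of_far (by omega) (by omega) (by omega)
  have hgk : SemiconjBy (g * k * g) k g := by
    rw [SemiconjBy]
    conv_rhs => rw [hbraid]
    simp only [mul_assoc]
  have hkg : SemiconjBy (g * k * g) g k := by
    rw [SemiconjBy]
    conv_lhs => rw [hbraid]
    simp only [mul_assoc]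
  refine ⟨s 1 * s 0 * (s 1 * s 0) * (g * k * g) * (s 4 * s 3),
    g * (s 1 * s 0 * (s 1 * s 0) * (g * k * g) * (s 4 * s 3)) * g⁻¹, ?_, ?_, ?_⟩
  · simp only [map_mul, hp0, hp3]
    simp (disch := omega) only [s, hs]
    decide +kernel
  · simp only [map_mul, map_inv, hp0, hp3]
    simp (disch := omega) only [s, hs]
    decide +kernel
  · refine sq_eq_sq_conj (b := s 4 * s 3 * (s 4 * s 3)) (c := s 7 * s 6 * (s 7 * s 6)) rfl
      (hAB.symm.mul_right hAB.symm)
      ((hAB.mul_right hAB).mul_left (hAB.mul_right hAB))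
      ((hBC.mul_right hBC).mul_left (hBC.mul_right hBC)) ?_ ?_
      (hw hg0.1 hg0.2) (hw hg0r.1 hg0r.2)
      (hw (hfar0 6 (by omega) (by omega)) (hfar0 7 (by omega) (by omega))) ?_
    · have fix0 : SemiconjBy g (s 6) (s 6) := hfar0 6 (by omega) (by omega)
      have fix1 : SemiconjBy g (s 7) (s 7) := hfar0 7 (by omega) (by omega)
      exact hw ((fix0.mul_left hg3.1).mul_left hg0.1) ((fix1.mul_left hg3.2).mul_left hg0.2)
    · have fix0 : SemiconjBy g (s 6) (s 6) := hfar0 6 (by omega) (by omega)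
      have fix1 : SemiconjBy g (s 7) (s 7) := hfar0 7 (by omega) (by omega)
      have fix2 : SemiconjBy k (s 0) (s 0) := hfar3 0 (by omega) (by omega)
      have fix3 : SemiconjBy k (s 1) (s 1) := hfar3 1 (by omega) (by omega)
      exact SemiconjBy.mul_right ((hg0.2.mul_left fix3).mul_left hg0r.2)
        ((hg0.1.mul_left fix2).mul_left hg0r.1)
    · exact (hgk.mul_left hkg).symm
end

section
/- Let m ≥ 2 and N ≥ 1, and let ρ₁, …, ρ_N be pairwise commuting permutations in S_m. Then there exist pairwise commuting elements β₁, …, β_N of the braid group B_m with π(βᵢ) = ρᵢ for every i. Equivalently, every group homomorphism from ℤ^N to S_m factors through the projection π : B_m → S_m. -/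
section GarsideElement

variable {G : Type*} [Group G]

/-- The product `s 0 * s 1 * ⋯ * s (k - 1)`. -/
def rangeProd (s : ℕ → G) (k : ℕ) : G := ((List.range k).map s).prod

lemma rangeProd_succ (s : ℕ → G) (k : ℕ) : rangeProd s (k + 1) = rangeProd s k * s k := by
  simp [rangeProd, List.prod_range_succ]

lemma rangeProd_succ' (s : ℕ → G) (k : ℕ) :
    rangeProd s (k + 1) = s 0 * rangeProd (fun i => s (i + 1)) k := by
  simp [rangeProd, List.prod_range_succ']

lemma commute_rangeProd {s : ℕ → G} {k : ℕ} {x : G} (h : ∀ i < k, Commute x (s i)) :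
    Commute x (rangeProd s k) := by
  refine Commute.list_prod_right _ _ fun y hy => ?_
  obtain ⟨i, hi, rfl⟩ := List.mem_map.1 hy
  exact h i (List.mem_range.1 hi)

lemma semiconjBy_rangeProd {s t : ℕ → G} {k : ℕ} {x : G} (h : ∀ i < k, SemiconjBy x (s i) (t i)) :
    SemiconjBy x (rangeProd s k) (rangeProd t k) := by
  induction k with
  | zero => simp [rangeProd]
  | succ k ih =>
    rw [rangeProd_succ, rangeProd_succ]
    exact (ih fun i hi => h i (by omega)).mul_right (h k (by omega))

/-- The first `N` terms of `s` satisfy the braid relations. -/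
structure IsBraidSeq_s10 (s : ℕ → G) (N : ℕ) : Prop where
  far : ∀ i j, i + 2 ≤ j → j < N → Commute (s i) (s j)
  braid : ∀ i, i + 1 < N → s i * s (i + 1) * s i = s (i + 1) * s i * s (i + 1)

namespace IsBraidSeq_s10

variable {s : ℕ → G} {N : ℕ}

lemma semiconjBy_rangeProd_gen (h : IsBraidSeq_s10 s N) {k i : ℕ} (hk : k ≤ N) (hi : i + 1 < k) :
    SemiconjBy (rangeProd s k) (s i) (s (i + 1)) := by
  induction k with
  | zero => omega
  | succ k ih =>
    rw [rangeProd_succ]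
    rcases Nat.lt_or_ge (i + 1) k with hik | hik
    · exact (ih (by omega) hik).mul_left (h.far i k (by omega) (by omega)).symm
    · obtain rfl : k = i + 1 := by omega
      have hc : Commute (s (i + 1)) (rangeProd s i) :=
        commute_rangeProd fun j hj => (h.far j (i + 1) (by omega) (by omega)).symm
      have hb := h.braid i (by omega)
      have hc' := hc.eq
      rw [rangeProd_succ]
      unfold SemiconjBy
      calc rangeProd s i * s i * s (i + 1) * s i
          = rangeProd s i * (s i * s (i + 1) * s i) := by group
        _ = (rangeProd s i * s (i + 1)) * (s i * s (i + 1)) := by rw [hb]; group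
        _ = _ := by rw [← hc']; group

lemma semiconjBy_pow_gen (h : IsBraidSeq_s10 s N) {t i : ℕ} (hi : i + t < N) :
    SemiconjBy (rangeProd s N ^ t) (s i) (s (i + t)) := by
  induction t with
  | zero => simp
  | succ t ih =>
    rw [pow_succ']
    exact (h.semiconjBy_rangeProd_gen le_rfl (by omega : i + t + 1 < N)).mul_left (ih (by omega))

lemma semiconjBy_sq_last (h : IsBraidSeq_s10 s (N + 1)) :
    SemiconjBy (rangeProd s (N + 1) ^ 2) (s N) (s 0) := by
  have key : SemiconjBy (rangeProd s (N + 1)) (rangeProd s N)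
      (rangeProd (fun i => s (i + 1)) N) :=
    semiconjBy_rangeProd fun i hi => h.semiconjBy_rangeProd_gen le_rfl (by omega)
  have e1 := rangeProd_succ s N
  have e2 := rangeProd_succ' s N
  unfold SemiconjBy at *
  generalize rangeProd s (N + 1) = d at *
  generalize rangeProd s N = p at *
  generalize rangeProd (fun i => s (i + 1)) N = r at *
  calc d ^ 2 * s N = s 0 * (r * d) * s N := by nth_rewrite 1 [pow_two, e2]; group
    _ = s 0 * (d * (p * s N)) := by rw [← key]; group
    _ = s 0 * d ^ 2 := by rw [← e1, pow_two]

lemma commute_pow_gen (h : IsBraidSeq_s10 s N) {i : ℕ} (hi : i < N) :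
    Commute (rangeProd s N ^ (N + 1)) (s i) := by
  obtain ⟨j, rfl⟩ : ∃ j, N = i + j + 1 := ⟨N - i - 1, by omega⟩
  have h1 := h.semiconjBy_pow_gen (t := j) (i := i) (by omega)
  have h3 := h.semiconjBy_pow_gen (t := i) (i := 0) (by omega)
  have := (h3.mul_left h.semiconjBy_sq_last).mul_left h1
  rw [← pow_add, ← pow_add, Nat.zero_add] at this
  rw [show i + j + 1 + 1 = i + 2 + j by ring]
  exact this

lemma semiconjBy_pow_wrap (h : IsBraidSeq_s10 s N) {t u i : ℕ} (htu : t + u = N + 1)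
    (hi : i + u < N) : SemiconjBy (rangeProd s N ^ t) (s (i + u)) (s i) := by
  have h1 := (h.semiconjBy_pow_gen hi).eq
  have h2 := (h.commute_pow_gen (i := i) (by omega)).eq
  rw [← htu, pow_add, mul_assoc, h1, ← mul_assoc, ← mul_assoc] at h2
  exact mul_right_cancel h2

end IsBraidSeq_s10

end GarsideElement

lemma swap_succ_commute {i j : ℕ} (h : i + 2 ≤ j) :
    Commute (Equiv.swap i (i + 1)) (Equiv.swap j (j + 1)) := by
  ext x
  simp only [Equiv.Perm.mul_apply, Equiv.swap_apply_def]
  split_ifs <;> omega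

lemma swap_succ_braid (i : ℕ) :
    Equiv.swap i (i + 1) * Equiv.swap (i + 1) (i + 1 + 1) * Equiv.swap i (i + 1) =
      Equiv.swap (i + 1) (i + 1 + 1) * Equiv.swap i (i + 1) *
        Equiv.swap (i + 1) (i + 1 + 1) := by
  ext x
  simp only [Equiv.Perm.mul_apply, Equiv.swap_apply_def]
  split_ifs <;> omega

lemma isBraidSeq_swap (N : ℕ) : IsBraidSeq_s10 (fun i => Equiv.swap i (i + 1)) N where
  far _ _ h _ := swap_succ_commute h
  braid i _ := swap_succ_braid i

namespace BraidGroup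

/-- The Artin generator with index `i`, or `1` when `i` is out of range. -/
def sigma (n i : ℕ) : BraidGroup n := if h : i < n - 1 then braidGen ⟨i, h⟩ else 1

lemma isBraidSeq_sigma (n : ℕ) : IsBraidSeq_s10 (sigma n) (n - 1) where
  far i j hij hj := by
    rw [sigma, sigma, dif_pos (by omega), dif_pos hj]
    have : (PresentedGroup.mk (braidRels (n - 1))) _ = 1 :=
      PresentedGroup.one_of_mem (Or.inl ⟨⟨i, by omega⟩, ⟨j, hj⟩, hij, rfl⟩)
    simp only [map_mul, map_inv] at this
    exact mul_inv_eq_iff_eq_mul.1 (mul_inv_eq_one.1 this)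
  braid i hi := by
    rw [sigma, sigma, dif_pos (by omega), dif_pos hi]
    have : (PresentedGroup.mk (braidRels (n - 1))) _ = 1 :=
      PresentedGroup.one_of_mem (Or.inr ⟨⟨i, by omega⟩, ⟨i + 1, hi⟩, rfl, rfl⟩)
    simp only [map_mul, map_inv] at this
    exact mul_inv_eq_one.1 this

/-- The homomorphism out of the braid group determined by a sequence satisfying the braid
relations. -/
def lift {G : Type*} [Group G] {n : ℕ} {s : ℕ → G} (h : IsBraidSeq_s10 s (n - 1)) :
    BraidGroup n →* G :=
  PresentedGroup.toGroup (f := fun i : Fin (n - 1) => s i) <| by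
    rintro r (⟨i, j, hij, rfl⟩ | ⟨i, j, hij, rfl⟩)
    · simp [(h.far i j hij j.2).eq]
    · have := h.braid i (by omega)
      simp only [map_mul, map_inv, FreeGroup.lift_apply_of, ← hij, this, mul_inv_cancel]

lemma lift_sigma {G : Type*} [Group G] {n : ℕ} {s : ℕ → G} (h : IsBraidSeq_s10 s (n - 1)) {i : ℕ}
    (hi : i < n - 1) : lift h (sigma n i) = s i := by
  rw [sigma, dif_pos hi]
  exact PresentedGroup.toGroup.of _

@[elab_as_elim]
lemma induction {n : ℕ} {p : BraidGroup n → Prop} (gen : ∀ i < n - 1, p (sigma n i)) (one : p 1)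
    (mul : ∀ x y, p x → p y → p (x * y)) (inv : ∀ x, p x → p x⁻¹) (x : BraidGroup n) : p x := by
  have hx : x ∈ Subgroup.closure (Set.range (PresentedGroup.of (rels := braidRels (n - 1)))) := by
    rw [PresentedGroup.closure_range_of]; trivial
  induction hx using Subgroup.closure_induction with
  | mem y hy =>
    obtain ⟨i, rfl⟩ := hy
    have := gen i i.2
    rwa [sigma, dif_pos i.2] at this
  | one => exact one
  | mul a b _ _ ha hb => exact mul a b ha hb
  | inv a _ ha => exact inv a ha

lemma semiconjBy_of_sigma {G : Type*} [Group G] {n : ℕ} {f g : BraidGroup n →* G} {x : G}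
    (h : ∀ i < n - 1, SemiconjBy x (f (sigma n i)) (g (sigma n i))) (α : BraidGroup n) :
    SemiconjBy x (f α) (g α) := by
  induction α using induction with
  | gen i hi => exact h i hi
  | one => simp
  | mul a b ha hb => simpa using ha.mul_right hb
  | inv a ha => simpa using ha.inv_right

/-- The permutation of `ℕ` underlying a braid on the strands `0, …, n - 1`. -/
def act (n : ℕ) : BraidGroup n →* Equiv.Perm ℕ := lift (isBraidSeq_swap (n - 1))

lemma act_sigma {n i : ℕ} (hi : i < n - 1) : act n (sigma n i) = Equiv.swap i (i + 1) :=
  lift_sigma _ hi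

lemma act_of_le {n x : ℕ} (hx : n ≤ x) (α : BraidGroup n) : act n α x = x := by
  induction α using induction with
  | gen i hi => rw [act_sigma hi]; exact Equiv.swap_apply_of_ne_of_ne (by omega) (by omega)
  | one => simp
  | mul a b ha hb => simp [ha, hb]
  | inv a ha => rw [map_inv, Equiv.Perm.inv_eq_iff_eq, ha]

lemma act_lt {n x : ℕ} (hx : x < n) (α : BraidGroup n) : act n α x < n := by
  by_contra! h
  have := (act n α).injective (act_of_le h α)
  omega

lemma coe_apply_eq_act {n : ℕ} {pr : BraidGroup n →* Equiv.Perm (Fin n)}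
    (hpr : ∀ i, pr (braidGen i) = Equiv.swap (finLow i) (finHigh i)) (α : BraidGroup n) :
    ∀ x : Fin n, (pr α x : ℕ) = act n α x := by
  induction α using induction with
  | gen i hi =>
    intro x
    rw [act_sigma hi, sigma, dif_pos hi, hpr]
    simp only [Equiv.swap_apply_def, finLow, finHigh, Fin.ext_iff]
    split_ifs <;> rfl
  | one => simp
  | mul a b ha hb => intro x; simp [ha, hb]
  | inv a ha =>
    intro x
    rw [map_inv, map_inv, eq_comm, Equiv.Perm.inv_eq_iff_eq, ← ha]
    simp

lemma surjective_of_swap {n : ℕ} {pr : BraidGroup n →* Equiv.Perm (Fin n)}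
    (hpr : ∀ i, pr (braidGen i) = Equiv.swap (finLow i) (finHigh i)) :
    Function.Surjective pr := by
  rcases n with - | n
  · exact fun τ => ⟨1, Subsingleton.elim _ _⟩
  · intro τ
    have hτ : τ ∈ Submonoid.closure
        (Set.range fun i : Fin n => Equiv.swap i.castSucc i.succ) := by
      rw [Equiv.Perm.mclosure_swap_castSucc_succ]; trivial
    have hle : Submonoid.closure (Set.range fun i : Fin n => Equiv.swap i.castSucc i.succ) ≤
        MonoidHom.mrange pr := by
      rw [Submonoid.closure_le]
      rintro _ ⟨i, rfl⟩
      exact ⟨braidGen (n := n + 1) i, hpr i⟩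
    exact hle hτ

/-- The cyclic rotation `σ₁ ⋯ σ_{n-1}`. -/
def delta (n : ℕ) : BraidGroup n := rangeProd (sigma n) (n - 1)

lemma act_rangeProd_sigma {n k : ℕ} (hk : k ≤ n - 1) (x : ℕ) :
    act n (rangeProd (sigma n) k) x = if x < k then x + 1 else if x = k then 0 else x := by
  induction k generalizing x with
  | zero => simp +contextual [rangeProd]
  | succ k ih =>
    rw [rangeProd_succ, map_mul, Equiv.Perm.mul_apply, act_sigma (by omega), ih (by omega)]
    simp only [Equiv.swap_apply_def]
    split_ifs <;> omega

lemma act_delta_pow {n x : ℕ} (hx : x < n) (t : ℕ) : act n (delta n ^ t) x = (x + t) % n := by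
  induction t with
  | zero => simp [Nat.mod_eq_of_lt hx]
  | succ t ih =>
    rw [pow_succ', map_mul, Equiv.Perm.mul_apply, ih, delta, act_rangeProd_sigma le_rfl,
      ← add_assoc, Nat.add_mod (x + t) 1]
    have hlt : (x + t) % n < n := Nat.mod_lt _ (by omega)
    generalize (x + t) % n = y at *
    rcases Nat.lt_or_ge 1 n with h1 | h1
    · rw [Nat.mod_eq_of_lt h1]
      split_ifs with h h'
      · rw [Nat.mod_eq_of_lt (by omega)]
      · rw [show y + 1 = n by omega, Nat.mod_self]
      · omega
    · obtain rfl : n = 1 := by omega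
      simp [Nat.mod_one]; omega

lemma isBraidSeq_sigma_add {p n k : ℕ} (h : k + p ≤ n) :
    IsBraidSeq_s10 (fun i => sigma n (k + i)) (p - 1) where
  far i j hij hj := (isBraidSeq_sigma n).far _ _ (by omega) (by omega)
  braid i hi := (isBraidSeq_sigma n).braid (k + i) (by omega)

/-- The braid on `n` strands which is the given braid on the strands `k, …, k + p - 1`. -/
def shift (p n k : ℕ) : BraidGroup p →* BraidGroup n :=
  if h : k + p ≤ n then lift (isBraidSeq_sigma_add h) else 1

lemma shift_sigma {p n k i : ℕ} (h : k + p ≤ n) (hi : i < p - 1) :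
    shift p n k (sigma p i) = sigma n (k + i) := by
  rw [shift, dif_pos h, lift_sigma _ hi]

lemma act_shift_add {p n k : ℕ} (h : k + p ≤ n) (α : BraidGroup p) :
    ∀ x, act n (shift p n k α) (k + x) = k + act p α x := by
  induction α using induction with
  | gen i hi =>
    intro x
    rw [shift_sigma h hi, act_sigma hi, act_sigma (by omega)]
    simp only [Equiv.swap_apply_def]
    split_ifs <;> omega
  | one => simp
  | mul a b ha hb => intro x; simp [ha, hb]
  | inv a ha =>
    intro x
    rw [map_inv, map_inv, Equiv.Perm.inv_eq_iff_eq, map_inv, ha]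
    simp

lemma act_shift_of_lt {p n k x : ℕ} (h : k + p ≤ n) (hx : x < k) (α : BraidGroup p) :
    act n (shift p n k α) x = x := by
  induction α using induction with
  | gen i hi =>
    rw [shift_sigma h hi, act_sigma (by omega)]
    exact Equiv.swap_apply_of_ne_of_ne (by omega) (by omega)
  | one => simp
  | mul a b ha hb => simp [ha, hb]
  | inv a ha => rw [map_inv, map_inv, Equiv.Perm.inv_eq_iff_eq, ha]

lemma act_shift_of_le {p n k x : ℕ} (h : k + p ≤ n) (hx : k + p ≤ x) (α : BraidGroup p) :
    act n (shift p n k α) x = x := by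
  obtain ⟨y, rfl⟩ : ∃ y, x = k + y := ⟨x - k, by omega⟩
  rw [act_shift_add h, act_of_le (by omega)]

lemma commute_shift_shift {p q n k l : ℕ} (hk : k + p ≤ l) (hl : l + q ≤ n) (α : BraidGroup p)
    (β : BraidGroup q) : Commute (shift p n k α) (shift q n l β) := by
  refine semiconjBy_of_sigma (f := shift q n l) (g := shift q n l) (fun j hj => ?_) β
  refine Commute.symm
    (semiconjBy_of_sigma (f := shift p n k) (g := shift p n k) (fun i hi => ?_) α)
  rw [shift_sigma (by omega) hi, shift_sigma hl hj]
  exact ((isBraidSeq_sigma n).far _ _ (by omega) (by omega)).symm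

/-- Parallel copies of a braid on `b` strands, in the first `k` of `a` consecutive blocks. -/
def copies (a b k : ℕ) (α : BraidGroup b) : BraidGroup (a * b) :=
  rangeProd (fun j => shift b (a * b) (b * j) α) k

lemma block_le {a b j : ℕ} (hj : j < a) : b * j + b ≤ a * b := by
  calc b * j + b = b * (j + 1) := by ring
    _ ≤ b * a := Nat.mul_le_mul_left _ hj
    _ = a * b := mul_comm _ _

lemma commute_shift_blocks {a b i j : ℕ} (hi : i < a) (hj : j < a) {α β : BraidGroup b}
    (h : Commute α β) : Commute (shift b (a * b) (b * i) α) (shift b (a * b) (b * j) β) := by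
  rcases lt_trichotomy i j with hij | rfl | hij
  · exact commute_shift_shift (by nlinarith) (block_le hj) _ _
  · exact h.map _
  · exact (commute_shift_shift (by nlinarith) (block_le hi) _ _).symm

lemma commute_copies {a b : ℕ} {α β : BraidGroup b} (h : Commute α β) :
    Commute (copies a b a α) (copies a b a β) :=
  commute_rangeProd fun _ hj =>
    (commute_rangeProd fun _ hi => (commute_shift_blocks hi hj h).symm).symm

lemma commute_delta_pow_copies {a b : ℕ} (α : BraidGroup b) :
    Commute (delta (a * b) ^ b) (copies a b a α) := by
  rcases a with - | a
  · simp [copies, rangeProd]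
  have hlast : (a + 1) * b = b * a + b := by ring
  have hstep : SemiconjBy (delta ((a + 1) * b) ^ b)
      (rangeProd (fun j => shift b ((a + 1) * b) (b * j) α) a)
      (rangeProd (fun j => shift b ((a + 1) * b) (b * (j + 1)) α) a) := by
    refine semiconjBy_rangeProd fun j hj => semiconjBy_of_sigma (fun i hi => ?_) α
    have h1 : b * j + b ≤ (a + 1) * b := block_le (by omega)
    have h2 : b * (j + 1) + b ≤ (a + 1) * b := block_le (by omega)
    have h3 : b * (j + 1) = b * j + b := by ring
    rw [shift_sigma h1 hi, shift_sigma h2 hi, show b * (j + 1) + i = b * j + i + b by omega]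
    exact (isBraidSeq_sigma _).semiconjBy_pow_gen (by omega)
  have hwrap : SemiconjBy (delta ((a + 1) * b) ^ b) (shift b ((a + 1) * b) (b * a) α)
      (shift b ((a + 1) * b) (b * 0) α) := by
    refine semiconjBy_of_sigma (fun i hi => ?_) α
    rw [shift_sigma (block_le (by omega)) hi, shift_sigma (block_le (by omega)) hi,
      show b * a + i = i + b * a by ring, show b * 0 + i = i by simp]
    exact (isBraidSeq_sigma _).semiconjBy_pow_wrap (by omega) (by omega)
  have hmove : Commute (shift b ((a + 1) * b) (b * 0) α)
      (rangeProd (fun j => shift b ((a + 1) * b) (b * (j + 1)) α) a) :=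
    commute_rangeProd fun j hj => commute_shift_blocks (by omega) (by omega) (Commute.refl α)
  have := hstep.mul_right hwrap
  rw [← hmove.eq, ← rangeProd_succ (fun j => shift b ((a + 1) * b) (b * j) α),
    ← rangeProd_succ' (fun j => shift b ((a + 1) * b) (b * j) α)] at this
  exact this

lemma act_copies {a b k x y : ℕ} (hk : k ≤ a) (hy : y < b) (α : BraidGroup b) :
    act (a * b) (copies a b k α) (b * x + y) = b * x + if x < k then act b α y else y := by
  induction k generalizing y with
  | zero => simp [copies, rangeProd]
  | succ k ih =>
    replace ih := fun {y} => @ih y (by omega)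
    unfold copies at *
    have hb : b * k + b ≤ a * b := block_le hk
    rw [rangeProd_succ, map_mul, Equiv.Perm.mul_apply]
    rcases lt_trichotomy x k with h | rfl | h
    · rw [act_shift_of_lt hb (by nlinarith), ih hy, if_pos h, if_pos (by omega)]
    · rw [act_shift_add hb, if_pos (by omega), ih (act_lt hy α), if_neg (by omega)]
    · rw [act_shift_of_le hb (by nlinarith), ih hy, if_neg (by omega), if_neg (by omega)]

end BraidGroup

open BraidGroup MulAction

/-- The action of `A` on `s`, after an enumeration of `s`, lifts elementwise to pairwise commuting
braids. -/
def HasBraidLift (A : Type*) {X : Type*} [SMul A X] (s : Set X) : Prop :=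
  ∃ (n : ℕ) (f : X → ℕ) (β : A → BraidGroup n), Set.BijOn f s (Set.Iio n) ∧
    (∀ a b, Commute (β a) (β b)) ∧ ∀ a, ∀ x ∈ s, act n (β a) (f x) = f (a • x)

namespace HasBraidLift

variable {A A' X X' : Type*} [SMul A X] [SMul A' X']

lemma transport (h : HasBraidLift A' (Set.univ : Set X')) (φ : A → A') {g : X' → X}
    (hg : g.Injective) (hsmul : ∀ a x, g (φ a • x) = a • g x) :
    HasBraidLift A (Set.range g) := by
  obtain ⟨n, f, β, hf, hβ, hact⟩ := h
  refine ⟨n, Function.extend g f 0, β ∘ φ, ⟨?_, ?_, ?_⟩, fun a b => hβ _ _, ?_⟩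
  · rintro _ ⟨x, rfl⟩
    rw [hg.extend_apply]
    exact hf.mapsTo trivial
  · rintro _ ⟨x, rfl⟩ _ ⟨y, rfl⟩ hxy
    rw [hg.extend_apply, hg.extend_apply] at hxy
    rw [hf.injOn trivial trivial hxy]
  · intro i hi
    obtain ⟨x, -, rfl⟩ := hf.surjOn hi
    exact ⟨g x, ⟨x, rfl⟩, hg.extend_apply _ _ _⟩
  · rintro a _ ⟨x, rfl⟩
    rw [← hsmul, hg.extend_apply, hg.extend_apply]
    exact hact _ _ trivial

lemma empty : HasBraidLift A (∅ : Set X) :=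
  ⟨0, 0, 1, by simp [Set.BijOn, Set.SurjOn], fun _ _ => Commute.refl _, by simp⟩

lemma union {s t : Set X} (hs : HasBraidLift A s) (ht : HasBraidLift A t) (hst : Disjoint s t)
    (hsA : ∀ (a : A), ∀ x ∈ s, a • x ∈ s) (htA : ∀ (a : A), ∀ x ∈ t, a • x ∈ t) :
    HasBraidLift A (s ∪ t) := by
  classical
  obtain ⟨p, f, β, hf, hβ, hβact⟩ := hs
  obtain ⟨q, g, γ, hg, hγ, hγact⟩ := ht
  have hp : 0 + p ≤ p + q := by omega
  have hts : ∀ x ∈ t, x ∉ s := fun x hx hx' => Set.disjoint_left.1 hst hx' hx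
  have hfs : ∀ x ∈ s, f x < p := fun x hx => hf.mapsTo hx
  have hgt : ∀ x ∈ t, g x < q := fun x hx => hg.mapsTo hx
  refine ⟨p + q, fun x => if x ∈ s then f x else p + g x,
    fun a => shift p (p + q) 0 (β a) * shift q (p + q) p (γ a), ⟨?_, ?_, ?_⟩, fun a b => ?_, ?_⟩
  · rintro x (hx | hx)
    · have := hfs x hx
      simp only [hx, if_true, Set.mem_Iio]
      omega
    · have := hgt x hx
      simp only [hts x hx, if_false, Set.mem_Iio]
      omega
  · rintro x (hx | hx) y (hy | hy) hxy
    · simp only [hx, hy, if_true] at hxy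
      exact hf.injOn hx hy hxy
    · have := hfs x hx
      simp only [hx, hts y hy, if_true, if_false] at hxy
      omega
    · have := hfs y hy
      simp only [hy, hts x hx, if_true, if_false] at hxy
      omega
    · simp only [hts x hx, hts y hy, if_false] at hxy
      exact hg.injOn hx hy (by omega)
  · intro i hi
    rcases Nat.lt_or_ge i p with hip | hip
    · obtain ⟨x, hx, rfl⟩ := hf.surjOn hip
      exact ⟨x, Or.inl hx, if_pos hx⟩
    · have hi : i < p + q := hi
      obtain ⟨x, hx, hxi⟩ := hg.surjOn (show i - p < q by omega)
      refine ⟨x, Or.inr hx, ?_⟩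
      simp only [hts x hx, if_false]
      omega
  · have h1 : ∀ c d, Commute (shift p (p + q) 0 (β c)) (shift q (p + q) p (γ d)) :=
      fun c d => commute_shift_shift (by omega) (by omega) _ _
    exact (((hβ a b).map _).mul_right (h1 a b)).mul_left
      ((h1 b a).symm.mul_right ((hγ a b).map _))
  · rintro a x (hx | hx)
    · have h1 := hfs x hx
      simp only [hx, hsA a x hx, if_true]
      rw [map_mul, Equiv.Perm.mul_apply, act_shift_of_lt le_rfl h1, ← hβact a x hx]
      simpa using act_shift_add hp (β a) (f x)
    · simp only [hts x hx, hts _ (htA a x hx), if_false]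
      rw [map_mul, Equiv.Perm.mul_apply, act_shift_add le_rfl, hγact a x hx,
        act_shift_of_le hp (by omega)]

/-- A cyclic group acting on an equal number of blocks, and `A` acting inside every block. -/
lemma prod_zmod {A : Type*} [Mul A] {a : ℕ} (ha : a ≠ 0)
    (h : HasBraidLift A (Set.univ : Set A)) :
    HasBraidLift (Multiplicative (ZMod a) × A) (Set.univ : Set (Multiplicative (ZMod a) × A)) := by
  obtain ⟨b, f, β, hf, hβ, hact⟩ := h
  have : NeZero a := ⟨ha⟩
  have hfb : ∀ x, f x < b := fun x => hf.mapsTo trivial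
  have hval : ∀ x : Multiplicative (ZMod a), x.toAdd.val < a := fun x => ZMod.val_lt _
  have hlt : ∀ x : Multiplicative (ZMod a) × A, b * x.1.toAdd.val + f x.2 < a * b := fun x =>
    (Nat.add_lt_add_left (hfb x.2) _).trans_le (block_le (hval x.1))
  refine ⟨a * b, fun x => b * x.1.toAdd.val + f x.2,
    fun x => (delta (a * b) ^ b) ^ x.1.toAdd.val * copies a b a (β x.2),
    ⟨fun x _ => hlt x, ?_, ?_⟩, fun x y => ?_, ?_⟩
  · rintro ⟨x, y⟩ - ⟨x', y'⟩ - hxy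
    simp only at hxy
    have hb : 0 < b := (Nat.zero_le _).trans_lt (hfb y)
    have h1 := congrArg (· / b) hxy
    have h2 := congrArg (· % b) hxy
    simp only [Nat.mul_add_div hb, Nat.mul_add_mod, Nat.div_eq_of_lt (hfb _), add_zero,
      Nat.mod_eq_of_lt (hfb _)] at h1 h2
    rw [hf.injOn trivial trivial h2]
    have := ZMod.val_injective a h1
    rw [Multiplicative.toAdd.injective this]
  · intro i hi
    have hi : i < a * b := hi
    have hb : 0 < b := Nat.pos_of_ne_zero (by rintro rfl; simp at hi)
    obtain ⟨y, -, hy⟩ := hf.surjOn (show i % b < b from Nat.mod_lt _ hb)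
    refine ⟨(Multiplicative.ofAdd ((i / b : ℕ) : ZMod a), y), trivial, ?_⟩
    simp only [toAdd_ofAdd]
    rw [hy, ZMod.val_natCast, Nat.mod_eq_of_lt (Nat.div_lt_of_lt_mul (by rwa [mul_comm])),
      Nat.div_add_mod]
  · have h1 : ∀ (k : ℕ) (c : A), Commute ((delta (a * b) ^ b) ^ k) (copies a b a (β c)) :=
      fun k c => (commute_delta_pow_copies _).pow_left k
    exact (((Commute.refl _).pow_pow _ _).mul_right (h1 _ _)).mul_left
      ((h1 _ _).symm.mul_right (commute_copies (hβ _ _)))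
  · rintro ⟨x, y⟩ ⟨x', y'⟩ -
    change act _ _ _ = b * (x.toAdd + x'.toAdd).val + f (y • y')
    have hs := Nat.div_add_mod (x.toAdd.val + x'.toAdd.val) a
    have hr := Nat.mod_lt (x.toAdd.val + x'.toAdd.val) (Nat.pos_of_ne_zero ha)
    have hy := hfb (y • y')
    rw [map_mul, Equiv.Perm.mul_apply, act_copies le_rfl (hfb _), if_pos (hval _),
      hact y y' trivial, ← pow_mul, act_delta_pow (hlt (x', y • y')), ZMod.val_add]
    generalize (x.toAdd.val + x'.toAdd.val) % a = r at *
    generalize (x.toAdd.val + x'.toAdd.val) / a = q at *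
    have hsum : b * x'.toAdd.val + f (y • y') + b * x.toAdd.val =
        b * r + f (y • y') + a * b * q := by
      rw [add_right_comm, ← mul_add, add_comm x'.toAdd.val, ← hs]
      ring
    rw [hsum, Nat.add_mul_mod_self_left, Nat.mod_eq_of_lt]
    exact (Nat.add_lt_add_left hy _).trans_le (block_le hr)

lemma pi_zmod {ι : Type} [Finite ι] : ∀ n : ι → ℕ, (∀ i, n i ≠ 0) →
    HasBraidLift (∀ i, Multiplicative (ZMod (n i)))
      (Set.univ : Set (∀ i, Multiplicative (ZMod (n i)))) := by
  induction ι using Finite.induction_empty_option with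
  | of_equiv e ih =>
    intro n hn
    have := (ih (fun i => n (e i)) fun i => hn _).transport (A := ∀ i, Multiplicative (ZMod (n i)))
      (fun x i => x (e i)) (g := (Equiv.piCongrLeft (fun i => Multiplicative (ZMod (n i))) e))
      (Equiv.injective _) fun a x => by
        rw [← Equiv.eq_symm_apply]
        ext i
        simp
    rwa [Equiv.range_eq_univ] at this
  | h_empty =>
    intro n _
    exact ⟨1, 0, 1, by simp [Set.BijOn, Set.SurjOn, Set.InjOn, Set.MapsTo],
      fun _ _ => Commute.refl _, by simp⟩
  | h_option ih =>
    intro n hn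
    let e := Equiv.piOptionEquivProd (β := fun i => Multiplicative (ZMod (n i)))
    have := ((ih (fun i => n (some i)) fun i => hn _).prod_zmod (hn none)).transport
      (A := ∀ i, Multiplicative (ZMod (n i))) e e.symm.injective fun a x => by
        rw [Equiv.symm_apply_eq]
        ext <;> simp [e]
    rwa [Equiv.range_eq_univ] at this

lemma regular (A : Type*) [CommGroup A] [Finite A] : HasBraidLift A (Set.univ : Set A) := by
  obtain ⟨ι, _, n, hn, ⟨e⟩⟩ := CommGroup.equiv_prod_multiplicative_zmod_of_finite A
  have := (pi_zmod n fun i => (zero_lt_one.trans (hn i)).ne').transport e e.symm.injective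
    fun a x => by simp
  rwa [e.symm.surjective.range_eq] at this

variable {A X : Type*} [CommGroup A] [MulAction A X] [Finite X]

lemma orbit (x : X) : HasBraidLift A (orbit A x) := by
  have hinj := injective_ofQuotientStabilizer A x
  have : Finite (A ⧸ stabilizer A x) := Finite.of_injective _ hinj
  have := (regular (A ⧸ stabilizer A x)).transport (fun a : A => (a : A ⧸ stabilizer A x)) hinj
    fun a y => by
      rw [← ofQuotientStabilizer_smul]
      induction y using QuotientGroup.induction_on
      rfl
  convert this
  ext y
  constructor
  · rintro ⟨a, rfl⟩
    exact ⟨a, rfl⟩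
  · rintro ⟨q, rfl⟩
    exact ofQuotientStabilizer_mem_orbit A x q

lemma univ (A X : Type*) [CommGroup A] [MulAction A X] [Finite X] :
    HasBraidLift A (Set.univ : Set X) := by
  classical
  cases nonempty_fintype X
  have key : ∀ T : Finset X, HasBraidLift A (⋃ x ∈ T, MulAction.orbit A x) := by
    intro T
    induction T using Finset.induction_on with
    | empty => simpa using empty
    | insert x T _ ih =>
      rw [Finset.set_biUnion_insert]
      have hinv : ∀ (a : A), ∀ y ∈ ⋃ x ∈ T, MulAction.orbit A x,
          a • y ∈ ⋃ x ∈ T, MulAction.orbit A x := by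
        intro a y hy
        simp only [Set.mem_iUnion] at hy ⊢
        obtain ⟨z, hz, hyz⟩ := hy
        exact ⟨z, hz, mem_orbit_of_mem_orbit a hyz⟩
      by_cases hx : x ∈ ⋃ x ∈ T, MulAction.orbit A x
      · rwa [Set.union_eq_self_of_subset_left]
        rintro _ ⟨a, rfl⟩
        exact hinv a x hx
      · refine (orbit x).union ih (Set.disjoint_left.2 ?_)
          (fun a y hy => mem_orbit_of_mem_orbit a hy) hinv
        rintro _ ⟨a, rfl⟩ h
        exact hx (by simpa using hinv a⁻¹ _ h)
  convert key Finset.univ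
  ext x
  simpa using ⟨x, mem_orbit_self x⟩

end HasBraidLift

/-- Pairwise commuting permutations `ρ₁, …, ρ_N ∈ S_m` lift to pairwise
commuting braids `β₁, …, β_N ∈ B_m`; equivalently, every homomorphism `ℤ^N → S_m` factors
through `π : B_m → S_m`. -/
theorem commuting_permutations_lift_to_commuting_braids
    (m N : ℕ) (hm : 2 ≤ m) (hN : 1 ≤ N)
    (pr : BraidGroup m →* Equiv.Perm (Fin m))
    (hpr : ∀ i : Fin (m - 1), pr (braidGen i) = Equiv.swap (finLow i) (finHigh i))
    (ρ : Fin N → Equiv.Perm (Fin m))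
    (hcomm : ∀ i j, Commute (ρ i) (ρ j)) :
    ∃ β : Fin N → BraidGroup m,
      (∀ i j, Commute (β i) (β j)) ∧
      (∀ i, pr (β i) = ρ i) := by
  have := Subgroup.isMulCommutative_closure (k := Set.range ρ) <| by
    rintro _ ⟨i, rfl⟩ _ ⟨j, rfl⟩
    exact hcomm i j
  open scoped IsMulCommutative in
  obtain ⟨n, f, β, hf, hβ, hact⟩ := HasBraidLift.univ (Subgroup.closure (Set.range ρ)) (Fin m)
  obtain rfl : m = n := by
    have := Set.ncard_congr (fun x _ => f x) hf.mapsTo (fun a b ha hb h => hf.injOn ha hb h)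
      fun i hi => by simpa using hf.surjOn hi
    simpa [Set.ncard_univ, ← Finset.coe_Iio, Set.ncard_coe_finset] using this
  have hfm : ∀ x, f x < m := fun x => hf.mapsTo trivial
  have hinj : Function.Injective fun x => (⟨f x, hfm x⟩ : Fin m) := fun x y hxy =>
    hf.injOn trivial trivial (congrArg Fin.val hxy)
  obtain ⟨t, ht⟩ := BraidGroup.surjective_of_swap hpr
    (Equiv.ofBijective _ (Finite.injective_iff_bijective.1 hinj))
  have htf : ∀ x, (pr t x : ℕ) = f x := fun x => by rw [ht]; rfl
  let a : Fin N → Subgroup.closure (Set.range ρ) := fun i =>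
    ⟨ρ i, Subgroup.subset_closure ⟨i, rfl⟩⟩
  refine ⟨fun i => t⁻¹ * β (a i) * t, fun i j => ?_, fun i => ?_⟩
  · simpa using (hβ (a i) (a j)).map (MulAut.conj t⁻¹)
  · ext x
    rw [map_mul, map_mul, map_inv, Equiv.Perm.mul_apply, Equiv.Perm.mul_apply]
    congr 1
    rw [Equiv.Perm.inv_eq_iff_eq, Fin.ext_iff, htf, BraidGroup.coe_apply_eq_act hpr, htf]
    exact hact (a i) x trivial
end

section
/- For every x, y ∈ ℤ² with k = ω(x,y), and every n ≥ 1, the n-th iterate of T_x ∘ T_y applied to x satisfies (T_x ∘ T_y)^n(x) = (1 − k²·Aₙ(k))·x − k·Bₙ(k)·y, and moreover T_y((T_x ∘ T_y)^n(x)) = (1 − k²·Aₙ(k))·x − k·B_{n+1}(k)·y, where Aₙ(k) and Bₙ(k) are the integer sequences defined by A₁(k) = B₁(k) = 1, A_{n+1}(k) = (1 − k²)Aₙ(k) + Bₙ(k) + 1, and B_{n+1}(k) = Bₙ(k) + 1 − k²·Aₙ(k). -/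
/-- The standard symplectic form on `ℤ²`: `ω((p,q),(r,s)) = p·s − q·r`. -/
def symp (x y : ℤ × ℤ) : ℤ := x.1 * y.2 - x.2 * y.1

/-- The transvection (Dehn twist on first homology of the torus) along `c`:
`T_c(v) = v + ω(c,v)·c`. -/
def transvect (c v : ℤ × ℤ) : ℤ × ℤ := v + symp c v • c

/-- The inverse transvection along `c`: `T_c⁻¹(v) = v − ω(c,v)·c`. -/
def transvectInv (c v : ℤ × ℤ) : ℤ × ℤ := v - symp c v • c

theorem transvect_left_smul_sub_smul (x y : ℤ × ℤ) (a b : ℤ) :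
    transvect x (a • x - b • y) = (a - symp x y * b) • x - b • y := by
  ext <;> simp [transvect, symp] <;> ring

theorem transvect_right_smul_sub_smul (x y : ℤ × ℤ) (a b : ℤ) :
    transvect y (a • x - b • y) = a • x - (b + symp x y * a) • y := by
  ext <;> simp [transvect, symp] <;> ring

/-- With `k = ω(x,y)` and integer sequences `Aₙ(k), Bₙ(k)` defined by
`A₁ = B₁ = 1`, `A_{n+1} = (1−k²)Aₙ + Bₙ + 1`, `B_{n+1} = Bₙ + 1 − k²Aₙ`, for all `n ≥ 1`:
`(T_x ∘ T_y)^n(x) = (1 − k²Aₙ(k))·x − k·Bₙ(k)·y` and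
`T_y((T_x ∘ T_y)^n(x)) = (1 − k²Aₙ(k))·x − k·B_{n+1}(k)·y`. -/
theorem same_handed_twist_region_formula
    (x y : ℤ × ℤ) (A B : ℕ → ℤ)
    (hA1 : A 1 = 1) (hB1 : B 1 = 1)
    (hArec : ∀ n, 1 ≤ n → A (n + 1) = (1 - symp x y ^ 2) * A n + B n + 1)
    (hBrec : ∀ n, 1 ≤ n → B (n + 1) = B n + 1 - symp x y ^ 2 * A n)
    (n : ℕ) (hn : 1 ≤ n) :
    (transvect x ∘ transvect y)^[n] x
        = (1 - symp x y ^ 2 * A n) • x - (symp x y * B n) • y ∧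
    transvect y ((transvect x ∘ transvect y)^[n] x)
        = (1 - symp x y ^ 2 * A n) • x - (symp x y * B (n + 1)) • y := by
  have transvect_right_step (m : ℕ) (hm : 1 ≤ m) :
      transvect y ((1 - symp x y ^ 2 * A m) • x - (symp x y * B m) • y)
        = (1 - symp x y ^ 2 * A m) • x - (symp x y * B (m + 1)) • y := by
    rw [transvect_right_smul_sub_smul, hBrec m hm]
    congr 2
    ring
  have iterate_eq : (transvect x ∘ transvect y)^[n] x
      = (1 - symp x y ^ 2 * A n) • x - (symp x y * B n) • y := by
    induction n, hn using Nat.le_induction with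
    | base =>
      have h := transvect_right_smul_sub_smul x y 1 0
      simp only [one_smul, zero_smul, sub_zero, zero_add, mul_one] at h
      have h' := transvect_left_smul_sub_smul x y 1 (symp x y)
      rw [one_smul] at h'
      rw [Function.iterate_one, Function.comp_apply, h, h', hA1, hB1, mul_one, mul_one, sq]
    | succ m hm ih =>
      rw [Function.iterate_succ_apply', ih, Function.comp_apply, transvect_right_step m hm,
        transvect_left_smul_sub_smul, hArec m hm, hBrec m hm]
      congr 2
      ring
  exact ⟨iterate_eq, by rw [iterate_eq, transvect_right_step n hn]⟩
end

section
/- For every x, y ∈ ℤ² with k = ω(x,y), and every n ≥ 1, the n-th iterate of T_x ∘ T_y^{−1} applied to x satisfies (T_x ∘ T_y^{−1})^n(x) = (1 + k²·Cₙ(k))·x + k·Dₙ(k)·y, and moreover T_y^{−1}((T_x ∘ T_y^{−1})^n(x)) = (1 + k²·Cₙ(k))·x + k·D_{n+1}(k)·y, where Cₙ(k) and Dₙ(k) are the integer sequences defined by C₁(k) = D₁(k) = 1, C_{n+1}(k) = (1 + k²)Cₙ(k) + Dₙ(k) + 1, and D_{n+1}(k) = Dₙ(k) + 1 + k²·Cₙ(k).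 -/
theorem transvect_smul_add_smul (x y : ℤ × ℤ) (a b : ℤ) :
    transvect x (a • x + b • y) = (a + b * symp x y) • x + b • y := by
  ext <;> simp [transvect, symp] <;> ring

theorem transvectInv_smul_add_smul (x y : ℤ × ℤ) (a b : ℤ) :
    transvectInv y (a • x + b • y) = a • x + (b + a * symp x y) • y := by
  ext <;> simp [transvectInv, symp] <;> ring

/-- With `k = ω(x,y)` and integer sequences `Cₙ(k), Dₙ(k)` defined by
`C₁ = D₁ = 1`, `C_{n+1} = (1+k²)Cₙ + Dₙ + 1`, `D_{n+1} = Dₙ + 1 + k²Cₙ`, for all `n ≥ 1`: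
`(T_x ∘ T_y⁻¹)^n(x) = (1 + k²Cₙ(k))·x + k·Dₙ(k)·y` and
`T_y⁻¹((T_x ∘ T_y⁻¹)^n(x)) = (1 + k²Cₙ(k))·x + k·D_{n+1}(k)·y`. -/
theorem opposite_handed_twist_region_formula
    (x y : ℤ × ℤ) (C D : ℕ → ℤ)
    (hC1 : C 1 = 1) (hD1 : D 1 = 1)
    (hCrec : ∀ n, 1 ≤ n → C (n + 1) = (1 + symp x y ^ 2) * C n + D n + 1)
    (hDrec : ∀ n, 1 ≤ n → D (n + 1) = D n + 1 + symp x y ^ 2 * C n)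
    (n : ℕ) (hn : 1 ≤ n) :
    (transvect x ∘ transvectInv y)^[n] x
        = (1 + symp x y ^ 2 * C n) • x + (symp x y * D n) • y ∧
    transvectInv y ((transvect x ∘ transvectInv y)^[n] x)
        = (1 + symp x y ^ 2 * C n) • x + (symp x y * D (n + 1)) • y := by
  have inv_step : ∀ m, 1 ≤ m →
      transvectInv y ((1 + symp x y ^ 2 * C m) • x + (symp x y * D m) • y)
        = (1 + symp x y ^ 2 * C m) • x + (symp x y * D (m + 1)) • y := by
    intro m hm
    rw [transvectInv_smul_add_smul, hDrec m hm]
    congr 2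
    ring
  have iterate_eq : (transvect x ∘ transvectInv y)^[n] x
      = (1 + symp x y ^ 2 * C n) • x + (symp x y * D n) • y := by
    induction n, hn using Nat.le_induction with
    | base =>
      have h := transvectInv_smul_add_smul x y 1 0
      simp only [one_smul, zero_smul, add_zero, zero_add, one_mul] at h
      have h' := transvect_smul_add_smul x y 1 (symp x y)
      rw [one_smul] at h'
      rw [Function.iterate_one, Function.comp_apply, h, h', hC1, hD1, mul_one, mul_one, sq]
    | succ m hm ih =>
      rw [Function.iterate_succ_apply', ih, Function.comp_apply, inv_step m hm,
        transvect_smul_add_smul, hCrec m hm, hDrec m hm]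
      congr 2
      ring
  exact ⟨iterate_eq, by rw [iterate_eq, inv_step n hn]⟩
end

section
/- Let k, l, m, a, b, c, d, e, f, g, h, i₀ be integers, let α, β be rational numbers, and let η₁, η₂, η₃ ∈ {1, −1}. Suppose the following equations hold in ℚ (integers coerced to ℚ): l = −α·k; m = −β·k; η₁(1 + k²a) = β(1 + m²g); η₁·k·b = α(1 + m²g) + m·i₀; η₂(1 + k²a) = α(1 + l²d); η₂·k·c = β(1 + l²d) + l·e; 1 + m²g = α(η₃·l·f − m·h); and 1 + l²d = −η₃·β(η₃·l·f − m·h). Then k, l, m are pairwise coprime: gcd(k,l) = gcd(l,m) = gcd(m,k) = 1. -/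
theorem Prime.not_dvd_one_add_sq_mul {p : ℤ} (hp : Prime p) {x : ℤ} (y : ℤ) (hx : p ∣ x) :
    ¬ p ∣ 1 + x ^ 2 * y := fun h =>
  hp.not_dvd_one ((dvd_add_left ((dvd_pow hx two_ne_zero).mul_right y)).1 h)

/-- (All-odd three-strand pretzel knots.) Under the system of equations
in `ℚ` coming from a hypothetical nontrivial simple `B₃`-coloring of `P(p,q,r)` with
`p, q, r` odd, the intersection numbers `k, l, m` are pairwise coprime. -/
theorem pretzel_all_odd_pairwise_coprime
    (k l m a b c d e f g h i₀ : ℤ) (α β : ℚ) (η₁ η₂ η₃ : ℤ)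
    (hη₁ : η₁ = 1 ∨ η₁ = -1) (hη₂ : η₂ = 1 ∨ η₂ = -1) (hη₃ : η₃ = 1 ∨ η₃ = -1)
    (h1 : (l : ℚ) = -α * (k : ℚ))
    (h2 : (m : ℚ) = -β * (k : ℚ))
    (h3 : (η₁ : ℚ) * (1 + (k : ℚ) ^ 2 * (a : ℚ)) = β * (1 + (m : ℚ) ^ 2 * (g : ℚ)))
    (h4 : (η₁ : ℚ) * ((k : ℚ) * (b : ℚ))
            = α * (1 + (m : ℚ) ^ 2 * (g : ℚ)) + (m : ℚ) * (i₀ : ℚ))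
    (h5 : (η₂ : ℚ) * (1 + (k : ℚ) ^ 2 * (a : ℚ)) = α * (1 + (l : ℚ) ^ 2 * (d : ℚ)))
    (h6 : (η₂ : ℚ) * ((k : ℚ) * (c : ℚ))
            = β * (1 + (l : ℚ) ^ 2 * (d : ℚ)) + (l : ℚ) * (e : ℚ))
    (h7 : (1 : ℚ) + (m : ℚ) ^ 2 * (g : ℚ)
            = α * ((η₃ : ℚ) * ((l : ℚ) * (f : ℚ)) - (m : ℚ) * (h : ℚ)))
    (h8 : (1 : ℚ) + (l : ℚ) ^ 2 * (d : ℚ)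
            = -(η₃ : ℚ) * β * ((η₃ : ℚ) * ((l : ℚ) * (f : ℚ)) - (m : ℚ) * (h : ℚ))) :
    IsCoprime k l ∧ IsCoprime l m ∧ IsCoprime m k := by
  have hk : (k : ℚ) ≠ 0 := by
    intro hk
    have hl : (l : ℚ) = 0 := by rw [h1, hk, mul_zero]
    have hm : (m : ℚ) = 0 := by rw [h2, hk, mul_zero]
    simp [hl, hm] at h7
  have hkz : k ≠ 0 := by exact_mod_cast hk
  have e4 : η₁ * (k * b) * k = -l * (1 + m ^ 2 * g) + m * i₀ * k := by
    have : (η₁ : ℚ) * (k * b) * k = -l * (1 + m ^ 2 * g) + m * i₀ * k := by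
      rw [h4, h1]; ring
    exact_mod_cast this
  have e5 : η₂ * (1 + k ^ 2 * a) * k = -l * (1 + l ^ 2 * d) := by
    have : (η₂ : ℚ) * (1 + k ^ 2 * a) * k = -l * (1 + l ^ 2 * d) := by
      rw [h5]; linear_combination (1 + (l : ℚ) ^ 2 * d) * h1
    exact_mod_cast this
  have e6 : η₂ * (k * c) * k = -m * (1 + l ^ 2 * d) + l * e * k := by
    have : (η₂ : ℚ) * (k * c) * k = -m * (1 + l ^ 2 * d) + l * e * k := by
      rw [h6]; linear_combination (1 + (l : ℚ) ^ 2 * d) * h2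
    exact_mod_cast this
  have e7 : (1 + m ^ 2 * g) * k = -l * (η₃ * (l * f) - m * h) := by
    have : (1 + (m : ℚ) ^ 2 * g) * k = -l * (η₃ * (l * f) - m * h) := by
      rw [h7]; linear_combination ((η₃ : ℚ) * (l * f) - m * h) * h1
    exact_mod_cast this
  have prod_eq : (1 + m ^ 2 * g) * (1 + l ^ 2 * d) =
      η₂ * (1 + k ^ 2 * a) * (η₃ * (l * f) - m * h) := by
    apply mul_right_cancel₀ hkz
    linear_combination (1 + l ^ 2 * d) * e7 - (η₃ * (l * f) - m * h) * e5
  have not_dvd_lm : ∀ p : ℤ, Prime p → p ∣ l → ¬ p ∣ m := by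
    intro p hp hl hm
    have hT : p ∣ η₃ * (l * f) - m * h :=
      dvd_sub ((hl.mul_right f).mul_left η₃) (hm.mul_right h)
    rcases hp.dvd_or_dvd (prod_eq ▸ hT.mul_left _) with hG | hD
    · exact hp.not_dvd_one_add_sq_mul g hm hG
    · exact hp.not_dvd_one_add_sq_mul d hl hD
  refine ⟨isCoprime_of_prime_dvd (fun h0 => hkz h0.1) ?_,
    isCoprime_of_prime_dvd ?_ not_dvd_lm,
    isCoprime_of_prime_dvd (fun h0 => hkz h0.2) ?_⟩
  · intro p hp hpk hpl
    have hmD : p ∣ m * (1 + l ^ 2 * d) := by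
      have : m * (1 + l ^ 2 * d) = k * (l * e - η₂ * (k * c)) := by linear_combination e6
      exact this ▸ hpk.mul_right _
    exact (hp.dvd_or_dvd hmD).elim (not_dvd_lm p hp hpl) (hp.not_dvd_one_add_sq_mul d hpl)
  · rintro ⟨rfl, rfl⟩
    simp [hkz] at e7
  · intro p hp hpm hpk
    have hlG : p ∣ l * (1 + m ^ 2 * g) := by
      have : l * (1 + m ^ 2 * g) = k * (m * i₀ - η₁ * (k * b)) := by linear_combination e4
      exact this ▸ hpk.mul_right _
    exact (hp.dvd_or_dvd hlG).elim (fun hpl => not_dvd_lm p hp hpl hpm)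
      (hp.not_dvd_one_add_sq_mul g hpm)
end

section
/- Let k, l, m, a, b, c, d, e, f, g, h, i₀ be integers, let α, β be rational numbers, and let η₁, η₂, η₃ ∈ {1, −1}. Suppose the following equations hold in ℚ (integers coerced to ℚ): l = −α·k; m = −β·k; η₁(1 + k²a) = α(1 − m²g) + m·i₀; η₁·k·b = β(1 − m²g); η₂·k·b = α(1 − l²d); η₂(1 + k²c) = β(1 − l²d) + l·e; 1 − m²g = α(η₃·l·f − m·h); and 1 − l²d = −η₃·β(η₃·l·f − m·h). Then k, l, m are pairwise coprime: gcd(k,l) = gcd(l,m) = gcd(m,k) = 1. -/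
/-- An integer is coprime to `1 - n ^ 2 * g` as soon as it divides `n`. -/
lemma isCoprime_one_sub_sq_mul_of_dvd {t n : ℤ} (g : ℤ) (ht : t ∣ n) :
    IsCoprime t (1 - n ^ 2 * g) := by
  obtain ⟨s, rfl⟩ := ht
  exact ⟨s * (t * s) * g, 1, by ring⟩

/-- If `k ^ 2` divides both `l` and `m` up to the factors `1 - l ^ 2 * d` and `1 - m ^ 2 * g`, and
`k * (1 - m ^ 2 * g)` lies in `l * (l, m)`, then `l` and `m` are coprime. -/
lemma isCoprime_of_sq_dvd_mul_one_sub {k l m d g s t : ℤ} (hlm : ¬(l = 0 ∧ m = 0))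
    (hl : k ^ 2 ∣ l * (1 - l ^ 2 * d)) (hm : k ^ 2 ∣ m * (1 - m ^ 2 * g))
    (hk : k * (1 - m ^ 2 * g) = l * (l * s + m * t)) : IsCoprime l m := by
  have hgl : gcd l m ∣ l := gcd_dvd_left l m
  have hgm : gcd l m ∣ m := gcd_dvd_right l m
  have hg0 : gcd l m ≠ 0 := fun h0 => hlm ((gcd_eq_zero_iff l m).1 h0)
  have hgcd : ∀ n, n ∣ l → n ∣ m → n ∣ gcd l m := fun n => dvd_gcd
  rw [← gcd_isUnit_iff]
  generalize gcd l m = r at hgl hgm hg0 hgcd ⊢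
  have hrk : r ^ 2 ∣ k := by
    refine (isCoprime_one_sub_sq_mul_of_dvd g hgm).pow_left.dvd_of_dvd_mul_right ?_
    rw [hk, sq]
    exact mul_dvd_mul hgl (dvd_add (hgl.mul_right s) (hgm.mul_right t))
  have hr4 : r ^ 4 ∣ k ^ 2 := by
    simpa [← pow_mul] using pow_dvd_pow_of_dvd hrk 2
  have hrl : r ^ 4 ∣ l :=
    (isCoprime_one_sub_sq_mul_of_dvd d hgl).pow_left.dvd_of_dvd_mul_right (hr4.trans hl)
  have hrm : r ^ 4 ∣ m :=
    (isCoprime_one_sub_sq_mul_of_dvd g hgm).pow_left.dvd_of_dvd_mul_right (hr4.trans hm)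
  have hr : r * r ^ 3 ∣ r * 1 := by
    simpa [← pow_succ'] using hgcd _ hrl hrm
  exact isUnit_of_dvd_one ((dvd_pow_self r three_ne_zero).trans ((mul_dvd_mul_iff_left hg0).1 hr))

/-- (Three-strand pretzel knots with one even parameter.) Under the
system of equations in `ℚ` coming from a hypothetical nontrivial simple `B₃`-coloring of
`P(p,q,r)` with `p` even and `q, r` odd, the intersection numbers `k, l, m` are pairwise
coprime. -/
theorem pretzel_one_even_pairwise_coprime
    (k l m a b c d e f g h i₀ : ℤ) (α β : ℚ) (η₁ η₂ η₃ : ℤ)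
    (hη₁ : η₁ = 1 ∨ η₁ = -1) (hη₂ : η₂ = 1 ∨ η₂ = -1) (hη₃ : η₃ = 1 ∨ η₃ = -1)
    (h1 : (l : ℚ) = -α * (k : ℚ))
    (h2 : (m : ℚ) = -β * (k : ℚ))
    (h3 : (η₁ : ℚ) * (1 + (k : ℚ) ^ 2 * (a : ℚ))
            = α * (1 - (m : ℚ) ^ 2 * (g : ℚ)) + (m : ℚ) * (i₀ : ℚ))
    (h4 : (η₁ : ℚ) * ((k : ℚ) * (b : ℚ)) = β * (1 - (m : ℚ) ^ 2 * (g : ℚ)))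
    (h5 : (η₂ : ℚ) * ((k : ℚ) * (b : ℚ)) = α * (1 - (l : ℚ) ^ 2 * (d : ℚ)))
    (h6 : (η₂ : ℚ) * (1 + (k : ℚ) ^ 2 * (c : ℚ))
            = β * (1 - (l : ℚ) ^ 2 * (d : ℚ)) + (l : ℚ) * (e : ℚ))
    (h7 : (1 : ℚ) - (m : ℚ) ^ 2 * (g : ℚ)
            = α * ((η₃ : ℚ) * ((l : ℚ) * (f : ℚ)) - (m : ℚ) * (h : ℚ)))
    (h8 : (1 : ℚ) - (l : ℚ) ^ 2 * (d : ℚ)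
            = -(η₃ : ℚ) * β * ((η₃ : ℚ) * ((l : ℚ) * (f : ℚ)) - (m : ℚ) * (h : ℚ))) :
    IsCoprime k l ∧ IsCoprime l m ∧ IsCoprime m k := by
  have hlm0 : ¬(l = 0 ∧ m = 0) := by
    rintro ⟨rfl, rfl⟩
    norm_num at h7
  have hl : l * (1 - l ^ 2 * d) = k ^ 2 * (-η₂ * b) := by
    qify
    linear_combination (1 - (l : ℚ) ^ 2 * d) * h1 + k * h5
  have hm : m * (1 - m ^ 2 * g) = k ^ 2 * (-η₁ * b) := by
    qify
    linear_combination (1 - (m : ℚ) ^ 2 * g) * h2 + k * h4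
  have hk : k * (1 - m ^ 2 * g) = l * (l * (-η₃ * f) + m * h) := by
    qify
    linear_combination k * h7 - ((l : ℚ) * (-η₃ * f) + m * h) * h1
  have hkl : l * (1 - m ^ 2 * g) = k * (m * i₀ - η₁ * (1 + k ^ 2 * a)) := by
    qify
    linear_combination (1 - (m : ℚ) ^ 2 * g) * h1 + k * h3
  have hkm : m * (1 - l ^ 2 * d) = k * (l * e - η₂ * (1 + k ^ 2 * c)) := by
    qify
    linear_combination (1 - (l : ℚ) ^ 2 * d) * h2 + k * h6
  have hlm : IsCoprime l m :=
    isCoprime_of_sq_dvd_mul_one_sub hlm0 (Dvd.intro _ hl.symm) (Dvd.intro _ hm.symm) hk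
  refine ⟨?_, hlm, ?_⟩
  · exact ((hlm.mul_right (isCoprime_one_sub_sq_mul_of_dvd d dvd_rfl)).of_isCoprime_of_dvd_right
      (Dvd.intro _ hkm.symm)).symm
  · exact (hlm.symm.mul_right (isCoprime_one_sub_sq_mul_of_dvd g dvd_rfl)).of_isCoprime_of_dvd_right
      (Dvd.intro _ hkl.symm)
end

section
/- Let n ≥ 2. There is no continuous function f : Circle → ℝ (where Circle is the unit circle in ℂ) such that for all z, w ∈ Circle with z ≠ w and z^n = w^n, one has f(z) ≠ f(w). In other words, the covering map z ↦ z^n of the circle over itself admits no continuous separating map into ℝ, and hence does not lift to a codimension-one braided embedding. -/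
/-- A continuous real-valued function on a nonempty compact connected space agrees somewhere
with its composite with any continuous self-map. -/
theorem exists_apply_map_eq {X : Type*} [TopologicalSpace X] [CompactSpace X] [ConnectedSpace X]
    {f : X → ℝ} (hf : Continuous f) {T : X → X} (hT : Continuous T) : ∃ x, f (T x) = f x := by
  obtain ⟨a, -, ha⟩ := isCompact_univ.exists_isMaxOn Set.univ_nonempty hf.continuousOn
  obtain ⟨b, -, hb⟩ := isCompact_univ.exists_isMinOn Set.univ_nonempty hf.continuousOn
  exact intermediate_value_univ₂ (hf.comp hT) hf (ha (Set.mem_univ (T a)))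
    (hb (Set.mem_univ (T b)))

theorem Circle.exists_pow_eq_one_ne_one {n : ℕ} (hn : 2 ≤ n) :
    ∃ ζ : Circle, ζ ^ n = 1 ∧ ζ ≠ 1 := by
  have : NeZero n := ⟨by omega⟩
  have : Fact (1 < n) := ⟨hn⟩
  refine ⟨(ZMod.toCircle (1 : ZMod n)), ?_, fun h => ?_⟩
  · rw [← AddChar.map_nsmul_eq_pow]
    simp
  · exact one_ne_zero (ZMod.injective_toCircle (h.trans (AddChar.map_zero_eq_one _).symm))

/-- For `n ≥ 2`, the `n`-fold covering `z ↦ zⁿ` of the circle over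
itself admits no continuous separating map into `ℝ`: there is no continuous
`f : Circle → ℝ` taking distinct values on distinct points of each fiber. Hence this
covering does not lift to a codimension-one braided embedding. -/
theorem no_separating_map_for_circle_cover
    (n : ℕ) (hn : 2 ≤ n) :
    ¬ ∃ f : Circle → ℝ, Continuous f ∧
        ∀ z w : Circle, z ≠ w → z ^ n = w ^ n → f z ≠ f w := by
  rintro ⟨f, hf, hsep⟩
  obtain ⟨ζ, hζn, hζ⟩ := Circle.exists_pow_eq_one_ne_one hn
  obtain ⟨x, hx⟩ := exists_apply_map_eq hf (continuous_const_mul ζ)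
  exact hsep (ζ * x) x (by simpa using hζ) (by rw [mul_pow, hζn, one_mul]) hx
end
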